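/- arXiv:1705.01594 — 2 statements merged into one kernel-verified Lean document; each statement's English description precedes it below -/
import Mathlib

section
/- Let R be a commutative Noetherian ring and I an ideal of R. Then cd(I, R) ≤ 1 if and only if for every R-module M, the vanishing Tor_0^R(R/I, M) = Tor_1^R(R/I, M) = 0 implies Tor_i^R(R/I, M) = 0 for all i ≥ 0. -/
open CategoryTheory

noncomputable section

universe u

/-- `Tor_i^R(A, B)` as an object of `ModuleCat R`. -/
def TorMod (R : Type u) [CommRing R] (i : ℕ) (A B : ModuleCat.{u} R) : ModuleCat.{u} R :=
  ((Tor (ModuleCat.{u} R) i).obj A).obj B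

/-- `Ext^i_R(A, B)` as an object of `ModuleCat R`. -/
def ExtMod (R : Type u) [CommRing R] (i : ℕ) (A B : ModuleCat.{u} R) : ModuleCat.{u} R :=
  ((Ext R (ModuleCat.{u} R) i).obj (Opposite.op A)).obj B

/-- `H^i_I(M)`, the `i`-th local cohomology of `M` with support in `I`. -/
def LC (R : Type u) [CommRing R] (I : Ideal R) (i : ℕ) (M : ModuleCat.{u} R) : ModuleCat.{u} R :=
  (localCohomology I i).obj M

/-- `M` is `I`-cofinite: `Supp M ⊆ V(I)` and all `Ext^i_R(R/I, M)` are finitely generated. -/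
def IsCofinite (R : Type u) [CommRing R] (I : Ideal R) (M : ModuleCat.{u} R) : Prop :=
  Module.support R M ⊆ PrimeSpectrum.zeroLocus (I : Set R) ∧
    ∀ i : ℕ, Module.Finite R (ExtMod R i (ModuleCat.of R (R ⧸ I)) M)

/-- `Γ_I(M) = ⋃ₙ (0 :_M Iⁿ)`, the `I`-torsion submodule of `M`. -/
def torsionGamma (R : Type u) [CommRing R] (I : Ideal R) (M : Type u) [AddCommGroup M]
    [Module R M] : Submodule R M :=
  ⨆ n : ℕ, Submodule.torsionBySet R M ((I ^ n : Ideal R) : Set R)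

namespace CD1

open CategoryTheory CategoryTheory.Abelian

lemma ses {R : Type u} [CommRing R] {A B C : Type u} [AddCommGroup A] [AddCommGroup B]
    [AddCommGroup C] [Module R A] [Module R B] [Module R C] (f : A →ₗ[R] B) (g : B →ₗ[R] C)
    (hf : Function.Injective f) (hg : Function.Surjective g) (h : Function.Exact f g) :
    (ShortComplex.moduleCatMk f g h.linearMap_comp_eq_zero).ShortExact := by
  have h1 : Mono (ShortComplex.moduleCatMk f g h.linearMap_comp_eq_zero).f :=
    (ModuleCat.mono_iff_injective _).2 hf
  have h2 : Epi (ShortComplex.moduleCatMk f g h.linearMap_comp_eq_zero).g :=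
    (ModuleCat.epi_iff_surjective _).2 hg
  refine ⟨(ShortComplex.ShortExact.moduleCat_exact_iff_function_exact _).2 h⟩

section
variable {R : Type u} [CommRing R] (I : Ideal R)

abbrev Qt (n : ℕ) : ModuleCat.{u} R := ModuleCat.of R (R ⧸ I ^ n)

def tr {n m : ℕ} (h : n ≤ m) : Qt I m ⟶ Qt I n :=
  ModuleCat.ofHom (Submodule.mapQ _ _ LinearMap.id (Ideal.pow_le_pow_right h))

lemma tr_tr {n m k : ℕ} (h : n ≤ m) (h' : m ≤ k) : tr I h' ≫ tr I h = tr I (h.trans h') := by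
  ext; rfl

lemma tr_mk {n m : ℕ} (h : n ≤ m) (r : R) :
    (tr I h).hom (Submodule.Quotient.mk r) = Submodule.Quotient.mk r := rfl

def V (i : ℕ) (W : ModuleCat.{u} R) : Prop :=
  ∀ (n : ℕ) (α : Abelian.Ext (Qt I n) W i), ∃ m, ∃ h : n ≤ m,
    (Ext.mk₀ (tr I h)).comp α (zero_add i) = 0

lemma tr_comp {n m k : ℕ} (h : n ≤ m) (h' : m ≤ k) {W : ModuleCat.{u} R} {i : ℕ}
    (α : Abelian.Ext (Qt I n) W i) :
    (Ext.mk₀ (tr I h')).comp ((Ext.mk₀ (tr I h)).comp α (zero_add i)) (zero_add i) =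
      (Ext.mk₀ (tr I (h.trans h'))).comp α (zero_add i) := by
  rw [Ext.mk₀_comp_mk₀_assoc, tr_tr]

section
variable (S : ShortComplex (ModuleCat.{u} R)) (hS : S.ShortExact)
include hS

lemma V_mid' (i : ℕ) (hA : V I i S.X₁) (hC : V I i S.X₃) : V I i S.X₂ := by
  intro n α
  obtain ⟨m, hm, h1⟩ := hC n (α.comp (Ext.mk₀ S.g) (add_zero i))
  obtain ⟨β, hβ⟩ := Ext.covariant_sequence_exact₂ (hS := hS) (X := Qt I m)
    ((Ext.mk₀ (tr I hm)).comp α (zero_add i)) (by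
      rw [Ext.comp_assoc_of_third_deg_zero]; exact h1)
  obtain ⟨k, hk, h2⟩ := hA m β
  refine ⟨k, hm.trans hk, ?_⟩
  rw [← tr_comp I hm hk, ← hβ, ← Ext.comp_assoc_of_third_deg_zero, h2, Ext.zero_comp]

lemma V_right' (i : ℕ) (hB : V I i S.X₂) (hA : V I (i+1) S.X₁) : V I i S.X₃ := by
  intro n α
  obtain ⟨m, hm, h1⟩ := hA n (α.comp hS.extClass rfl)
  obtain ⟨β, hβ⟩ := Ext.covariant_sequence_exact₃ (hS := hS) (X := Qt I m)
    (x₃ := (Ext.mk₀ (tr I hm)).comp α (zero_add i)) (n₁ := i+1) rfl (by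
      rw [Ext.comp_assoc _ _ _ _ (rfl : i + 1 = i + 1) (by omega)]; exact h1)
  obtain ⟨k, hk, h2⟩ := hB m β
  refine ⟨k, hm.trans hk, ?_⟩
  rw [← tr_comp I hm hk, ← hβ, ← Ext.comp_assoc_of_third_deg_zero, h2, Ext.zero_comp]

lemma V_left' (i : ℕ) (hC : V I i S.X₃) (hB : V I (i+1) S.X₂) : V I (i+1) S.X₁ := by
  intro n α
  obtain ⟨m, hm, h1⟩ := hB n (α.comp (Ext.mk₀ S.f) (add_zero _))
  obtain ⟨β, hβ⟩ := Ext.covariant_sequence_exact₁ (hS := hS) (X := Qt I m)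
    (x₁ := (Ext.mk₀ (tr I hm)).comp α (zero_add _)) (n₀ := i) (by
      rw [Ext.comp_assoc_of_third_deg_zero]; exact h1) rfl
  obtain ⟨k, hk, h2⟩ := hC m β
  refine ⟨k, hm.trans hk, ?_⟩
  rw [← tr_comp I hm hk, ← hβ, ← Ext.comp_assoc _ _ _ (zero_add i) _ (by omega), h2,
    Ext.zero_comp]

/-- special degree one case -/
lemma V_left_zero' (hC : ∀ c : S.X₃, ∃ b, S.g.hom b = c ∧ ∃ n, ∀ a ∈ I ^ n, a • b = 0)
    (hB : V I 1 S.X₂) : V I 1 S.X₁ := by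
  intro n α
  obtain ⟨m, hm, h1⟩ := hB n (α.comp (Ext.mk₀ S.f) (add_zero _))
  obtain ⟨β, hβ⟩ := Ext.covariant_sequence_exact₁ (hS := hS) (X := Qt I m)
    (x₁ := (Ext.mk₀ (tr I hm)).comp α (zero_add _)) (n₀ := 0) (by
      rw [Ext.comp_assoc_of_third_deg_zero]; exact h1) rfl
  obtain ⟨b, rfl⟩ := Ext.mk₀_bijective _ _ |>.2 β
  obtain ⟨y, hy, k, hk⟩ := hC (b.hom (Submodule.Quotient.mk 1))
  let l := max m k
  let c : Qt I l ⟶ S.X₂ := ModuleCat.ofHom (Submodule.liftQ _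
    (LinearMap.toSpanSingleton R S.X₂ y) (fun a ha => by
      simpa using hk a (Ideal.pow_le_pow_right (le_max_right _ _) ha)))
  have hc : tr I (le_max_left m k) ≫ b = c ≫ S.g := by
    ext
    change b.hom (Submodule.Quotient.mk 1) = S.g.hom (c.hom (Submodule.Quotient.mk 1))
    rw [← hy]
    congr 1
    change y = (1 : R) • y
    simp
  refine ⟨l, hm.trans (le_max_left _ _), ?_⟩
  rw [← tr_comp I hm (le_max_left m k), ← hβ, Ext.mk₀_comp_mk₀_assoc, hc,
    ← Ext.mk₀_comp_mk₀_assoc, hS.comp_extClass, Ext.comp_zero]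
end

section
variable {A B C : Type u} [AddCommGroup A] [AddCommGroup B]
    [AddCommGroup C] [Module R A] [Module R B] [Module R C] (f : A →ₗ[R] B) (g : B →ₗ[R] C)
    (hf : Function.Injective f) (hg : Function.Surjective g) (h : Function.Exact f g)
include hf hg h

lemma V_mid (i : ℕ) (hA : V I i (ModuleCat.of R A)) (hC : V I i (ModuleCat.of R C)) :
    V I i (ModuleCat.of R B) :=
  V_mid' I _ (ses f g hf hg h) i hA hC

lemma V_right (i : ℕ) (hB : V I i (ModuleCat.of R B)) (hA : V I (i+1) (ModuleCat.of R A)) :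
    V I i (ModuleCat.of R C) :=
  V_right' I _ (ses f g hf hg h) i hB hA

lemma V_left (i : ℕ) (hC : V I i (ModuleCat.of R C)) (hB : V I (i+1) (ModuleCat.of R B)) :
    V I (i+1) (ModuleCat.of R A) :=
  V_left' I _ (ses f g hf hg h) i hC hB

lemma V_left_zero (hC : ∀ c : C, ∃ b, g b = c ∧ ∃ n, ∀ a ∈ I ^ n, a • b = 0)
    (hB : V I 1 (ModuleCat.of R B)) : V I 1 (ModuleCat.of R A) :=
  V_left_zero' I _ (ses f g hf hg h) hC hB
end

end

end CD1

namespace CD1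

open CategoryTheory CategoryTheory.Abelian

section
variable {R : Type u} [CommRing R] (I : Ideal R)

def Tors (W : Type u) [AddCommGroup W] [Module R W] : Prop :=
  ∀ w : W, ∃ n, ∀ a ∈ I ^ n, a • w = 0

def Gam (W : Type u) [AddCommGroup W] [Module R W] : Submodule R W where
  carrier := {w | ∃ n, ∀ a ∈ I ^ n, a • w = 0}
  add_mem' := by
    rintro x y ⟨n, hn⟩ ⟨m, hm⟩
    refine ⟨max n m, fun a ha => ?_⟩
    rw [smul_add, hn a (Ideal.pow_le_pow_right (le_max_left _ _) ha),
      hm a (Ideal.pow_le_pow_right (le_max_right _ _) ha), add_zero]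
  zero_mem' := ⟨0, fun a _ => smul_zero a⟩
  smul_mem' := by
    rintro c x ⟨n, hn⟩
    exact ⟨n, fun a ha => by rw [smul_comm, hn a ha, smul_zero]⟩

lemma mem_Gam {W : Type u} [AddCommGroup W] [Module R W] {w : W} :
    w ∈ Gam I W ↔ ∃ n, ∀ a ∈ I ^ n, a • w = 0 := Iff.rfl

lemma tors_Gam (W : Type u) [AddCommGroup W] [Module R W] : Tors I (Gam I W) := by
  rintro ⟨w, n, hn⟩
  exact ⟨n, fun a ha => Subtype.ext (hn a ha)⟩

lemma Tors.of_surj {W W' : Type u} [AddCommGroup W] [Module R W] [AddCommGroup W'] [Module R W']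
    (f : W →ₗ[R] W') (hf : Function.Surjective f) (h : Tors I W) : Tors I W' := by
  intro w
  obtain ⟨w, rfl⟩ := hf w
  obtain ⟨n, hn⟩ := h w
  exact ⟨n, fun a ha => by rw [← map_smul, hn a ha, map_zero]⟩

/-- a f.g. torsion submodule is killed by a power -/
lemma fg_killed {W : Type u} [AddCommGroup W] [Module R W] (N : Submodule R W) (hN : N.FG)
    (h : ∀ w ∈ N, ∃ n, ∀ a ∈ I ^ n, a • w = 0) : ∃ n, ∀ w ∈ N, ∀ a ∈ I ^ n, a • w = 0 := by
  classical
  obtain ⟨s, rfl⟩ := hN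
  have h' : ∀ w : s, ∃ n, ∀ a ∈ I ^ n, a • (w : W) = 0 := fun w => h _ (Submodule.subset_span w.2)
  choose n hn using h'
  refine ⟨s.attach.sup n, fun w hw a ha => ?_⟩
  induction hw using Submodule.span_induction with
  | mem x hx =>
    exact hn ⟨x, hx⟩ a (Ideal.pow_le_pow_right (Finset.le_sup (Finset.mem_attach s ⟨x, hx⟩)) ha)
  | zero => simp
  | add x y _ _ hx hy => rw [smul_add, hx, hy, add_zero]
  | smul c x _ hx => rw [smul_comm, hx, smul_zero]

lemma Gam_injective [IsNoetherianRing R] (E : Type u) [AddCommGroup E] [Module R E]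
    [hE : Module.Injective R E] : Module.Injective R (Gam I E) := by
  apply Module.Baer.injective
  intro J g
  obtain ⟨n, hn⟩ := fg_killed I (LinearMap.range g)
    (by rw [LinearMap.range_eq_map]; exact (Module.Finite.fg_top (R := R) (M := J)).map g)
    (fun w _ => tors_Gam I E w)
  obtain ⟨k, hk⟩ := Ideal.exists_pow_inf_eq_pow_smul (M := R) I (J : Submodule R R)
  have key : ∀ a (ha : a ∈ J), a ∈ I ^ (n + k) → g ⟨a, ha⟩ = 0 := by
    intro a ha haI
    have h1 := hk (n + k) (by omega)
    have h2 : a ∈ I ^ (n+k) • (⊤ : Submodule R R) ⊓ J := ⟨by simpa using haI, ha⟩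
    rw [h1] at h2
    have h3 : I ^ (n + k - k) • (I ^ k • (⊤ : Submodule R R) ⊓ J) ≤
        (LinearMap.ker g).map J.subtype := by
      rw [Submodule.smul_le]
      rintro r hr x ⟨-, hx⟩
      refine ⟨r • ⟨x, hx⟩, ?_, rfl⟩
      rw [SetLike.mem_coe, LinearMap.mem_ker, map_smul]
      exact hn _ ⟨_, rfl⟩ r (by simpa using hr)
    obtain ⟨b, hb, hba⟩ := h3 h2
    have : b = ⟨a, ha⟩ := Subtype.ext hba
    rw [← this]; exact hb
  let f : (J ⧸ (Submodule.comap J.subtype (I ^ (n+k)))) →ₗ[R] (R ⧸ I ^ (n + k)) :=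
    Submodule.mapQ _ _ J.subtype le_rfl
  have hf : Function.Injective f := by
    rw [← LinearMap.ker_eq_bot, LinearMap.ker_eq_bot']
    intro x hx
    obtain ⟨x, rfl⟩ := Submodule.mkQ_surjective _ x
    simp only [f, Submodule.mkQ_apply, Submodule.mapQ_apply] at hx
    rw [Submodule.Quotient.mk_eq_zero] at hx
    rw [Submodule.mkQ_apply, Submodule.Quotient.mk_eq_zero]
    exact hx
  let g1 : (J ⧸ (Submodule.comap J.subtype (I ^ (n+k)))) →ₗ[R] E :=
    Submodule.liftQ _ ((Gam I E).subtype ∘ₗ g) (by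
      rintro ⟨x, hx⟩ hx'
      simp only [LinearMap.mem_ker, LinearMap.comp_apply]
      rw [key x hx hx', map_zero])
  obtain ⟨h, hh⟩ := hE.out f hf g1
  refine ⟨LinearMap.toSpanSingleton R _ ⟨h (Submodule.Quotient.mk 1), n + k, fun a ha => ?_⟩, ?_⟩
  · rw [← map_smul, ← Submodule.Quotient.mk_smul, smul_eq_mul, mul_one,
      (Submodule.Quotient.mk_eq_zero _).2 ha, map_zero]
  · intro x hx
    apply Subtype.ext
    have := hh (Submodule.Quotient.mk ⟨x, hx⟩)
    simp only [LinearMap.toSpanSingleton_apply, Submodule.coe_smul]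
    rw [← map_smul, ← Submodule.Quotient.mk_smul, smul_eq_mul, mul_one]
    exact this

lemma V_of_injective (E : Type u) [AddCommGroup E] [Module R E]
    [hE : Module.Injective R E] (i : ℕ) : V I (i+1) (ModuleCat.of R E) := by
  intro n α
  have := Module.injective_object_of_injective_module R E
  exact ⟨n, le_rfl, by rw [Ext.eq_zero_of_injective α, Ext.comp_zero]⟩

lemma exists_inj (W : Type u) [AddCommGroup W] [Module R W] :
    ∃ (E : Type u) (_ : AddCommGroup E) (_ : Module R E) (_ : Module.Injective R E)
      (f : W →ₗ[R] E), Function.Injective f := by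
  let X := ModuleCat.of R W
  refine ⟨(Injective.under X : ModuleCat.{u} R), inferInstance, inferInstance, ?_,
    (Injective.ι X).hom, ?_⟩
  · have : Injective (ModuleCat.of R (Injective.under X : ModuleCat.{u} R)) :=
      inferInstanceAs (Injective (Injective.under X))
    exact Module.injective_module_of_injective_object R _
  · exact (ModuleCat.mono_iff_injective _).1 inferInstance

lemma V_tors [IsNoetherianRing R] (i : ℕ) (W : Type u) [AddCommGroup W] [Module R W]
    (hW : Tors I W) : V I (i+1) (ModuleCat.of R W) := by
  induction i generalizing W with
  | zero =>
    obtain ⟨E, _, _, _, f, hf⟩ := exists_inj (R := R) W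
    have := Gam_injective I E
    let f' : W →ₗ[R] Gam I E := f.codRestrict _ (fun w => by
      obtain ⟨n, hn⟩ := hW w
      exact ⟨n, fun a ha => by rw [← map_smul, hn a ha, map_zero]⟩)
    refine V_left_zero I f' (LinearMap.range f').mkQ (fun x y h => hf (congrArg Subtype.val h))
      (Submodule.mkQ_surjective _) ?_ ?_ (V_of_injective I _ 0)
    · rw [LinearMap.exact_iff, Submodule.ker_mkQ]
    · intro c
      obtain ⟨b, rfl⟩ := Submodule.mkQ_surjective _ c
      exact ⟨b, rfl, tors_Gam I E b⟩
  | succ i ih =>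
    obtain ⟨E, _, _, _, f, hf⟩ := exists_inj (R := R) W
    have := Gam_injective I E
    let f' : W →ₗ[R] Gam I E := f.codRestrict _ (fun w => by
      obtain ⟨n, hn⟩ := hW w
      exact ⟨n, fun a ha => by rw [← map_smul, hn a ha, map_zero]⟩)
    refine V_left I f' (LinearMap.range f').mkQ (fun x y h => hf (congrArg Subtype.val h))
      (Submodule.mkQ_surjective _) ?_ _ (ih _ ?_) (V_of_injective I _ (i+1))
    · rw [LinearMap.exact_iff, Submodule.ker_mkQ]
    · exact Tors.of_surj I _ (Submodule.mkQ_surjective _) (tors_Gam I E)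

end
end CD1

namespace CD1

open CategoryTheory CategoryTheory.Abelian

section
variable {R : Type u} [CommRing R] (I : Ideal R)

lemma V_of_bij (i : ℕ) (W : Type u) [AddCommGroup W] [Module R W] (x : R) (hx : x ∈ I)
    (hb : Function.Bijective (fun w : W => x • w)) : V I i (ModuleCat.of R W) := by
  intro n α
  refine ⟨n, le_rfl, ?_⟩
  suffices α = 0 by rw [this, Ext.comp_zero]
  have h0 : (x ^ n) • 𝟙 (Qt I n) = 0 := by
    ext
    change x ^ n • (Submodule.Quotient.mk 1 : R ⧸ I ^ n) = 0
    rw [← Submodule.Quotient.mk_smul, smul_eq_mul, mul_one, Submodule.Quotient.mk_eq_zero]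
    exact Ideal.pow_mem_pow hx n
  have h1 : (x ^ n) • α = 0 := by
    have : (Ext.mk₀ ((x ^ n) • 𝟙 (Qt I n))).comp α (zero_add i) = x ^ n • α := by
      rw [Ext.mk₀_smul, Ext.smul_comp, Ext.mk₀_id_comp]
    rw [← this, h0, Ext.mk₀_zero, Ext.zero_comp]
  rw [Ext.smul_eq_comp_mk₀] at h1
  have hb' : Function.Bijective (fun w : W => x ^ n • w) := by
    have := hb.iterate n
    convert this using 1
    exact (smul_iterate x n).symm
  have : IsIso ((x ^ n) • 𝟙 (ModuleCat.of R W)) := by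
    rw [ConcreteCategory.isIso_iff_bijective]
    exact hb'
  have h2 := congrArg (fun β => β.comp (Ext.mk₀ (inv ((x ^ n) • 𝟙 (ModuleCat.of R W))))
    (add_zero i)) h1
  simp only [Ext.zero_comp] at h2
  rwa [Ext.comp_assoc_of_third_deg_zero, Ext.mk₀_comp_mk₀, IsIso.hom_inv_id, Ext.comp_mk₀_id] at h2

lemma tors_of_nilp [IsNoetherianRing R] (W : Type u) [AddCommGroup W] [Module R W]
    (h : I ≤ Ideal.span {x : R | ∀ w : W, ∃ n : ℕ, x ^ n • w = 0}) : Tors I W := by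
  intro w
  have : I ≤ (Ideal.torsionOf R W w).radical := by
    refine h.trans (Ideal.span_le.2 ?_)
    intro x hx
    obtain ⟨n, hn⟩ := hx w
    exact ⟨n, hn⟩
  obtain ⟨n, hn⟩ := Ideal.exists_pow_le_of_le_radical_of_fg this (IsNoetherian.noetherian I)
  exact ⟨n, fun a ha => hn ha⟩

lemma V_bound [IsNoetherianRing R] (L : List R) (hL : ∀ x ∈ L, x ∈ I) (W : Type u)
    [AddCommGroup W] [Module R W]
    (h : I ≤ Ideal.span ({x | x ∈ L} ∪ {x : R | ∀ w : W, ∃ n : ℕ, x ^ n • w = 0})) (i : ℕ)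
    (hi : L.length < i) : V I i (ModuleCat.of R W) := by
  induction L generalizing W i with
  | nil =>
    obtain ⟨j, rfl⟩ : ∃ j, i = j + 1 := ⟨i - 1, by simp at hi; omega⟩
    exact V_tors I j W (tors_of_nilp I W (by simpa using h))
  | cons x L ih =>
    obtain ⟨j, rfl⟩ : ∃ j, i = j + 1 := ⟨i - 1, by simp at hi; omega⟩
    have hj : L.length < j := by simpa using hi
    have ih := ih (fun y hy => hL y (List.mem_cons_of_mem _ hy))
    let S := Submonoid.powers x
    let f := LocalizedModule.mkLinearMap S W
    have hloc : V I (j+1) (ModuleCat.of R (LocalizedModule S W)) := by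
      refine V_of_bij I _ _ x (hL x List.mem_cons_self) ?_
      exact (Module.End.isUnit_iff _).1 (IsLocalizedModule.map_units f ⟨x, Submonoid.mem_powers x⟩)
    have aux : ∀ (W' : Type u) [AddCommGroup W'] [Module R W'],
        (∀ w : W', ∃ n : ℕ, x ^ n • w = 0) →
        (∀ y : R, (∀ w : W, ∃ n : ℕ, y ^ n • w = 0) → (∀ w : W', ∃ n : ℕ, y ^ n • w = 0)) →
        I ≤ Ideal.span ({x | x ∈ L} ∪ {x : R | ∀ w : W', ∃ n : ℕ, x ^ n • w = 0}) := by
      intro W' _ _ h1 h2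
      refine h.trans (Ideal.span_mono ?_)
      rintro y (hy | hy)
      · rcases List.mem_cons.1 hy with rfl | hy
        · exact Or.inr h1
        · exact Or.inl hy
      · exact Or.inr (h2 y hy)
    have hker : V I (j+1) (ModuleCat.of R (LinearMap.ker f)) := by
      refine ih _ (aux _ ?_ ?_) _ (by omega)
      · rintro ⟨w, hw⟩
        obtain ⟨r, ⟨n, rfl⟩, hr⟩ := LocalizedModule.mem_ker_mkLinearMap_iff.1 hw
        exact ⟨n, Subtype.ext hr⟩
      · rintro y hy ⟨w, hw⟩
        obtain ⟨n, hn⟩ := hy w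
        exact ⟨n, Subtype.ext hn⟩
    have hcok : V I j (ModuleCat.of R (LocalizedModule S W ⧸ LinearMap.range f)) := by
      refine ih _ (aux _ ?_ ?_) _ hj
      · intro w
        obtain ⟨w, rfl⟩ := Submodule.mkQ_surjective _ w
        obtain ⟨⟨w0, s⟩, hs⟩ := IsLocalizedModule.surj S f w
        obtain ⟨n, hn⟩ := s.2
        refine ⟨n, ?_⟩
        rw [← map_smul, Submodule.mkQ_apply, Submodule.Quotient.mk_eq_zero]
        refine ⟨w0, ?_⟩
        rw [← hs]
        change x ^ n = _ at hn
        rw [hn]; rfl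
      · intro y hy w
        obtain ⟨w, rfl⟩ := Submodule.mkQ_surjective _ w
        obtain ⟨⟨w0, s⟩, hs⟩ := IsLocalizedModule.surj S f w
        obtain ⟨n, hn⟩ := hy w0
        refine ⟨n, ?_⟩
        have : y ^ n • w = 0 := by
          apply ((Module.End.isUnit_iff _).1 (IsLocalizedModule.map_units f s)).1
          change s • y ^ n • w = s • 0
          rw [smul_zero, smul_comm, hs, ← map_smul, hn, map_zero]
        rw [← map_smul, this, map_zero]
    have hrange : V I (j+1) (ModuleCat.of R (LinearMap.range f)) := by
      refine V_left I (LinearMap.range f).subtype (LinearMap.range f).mkQ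
        (Submodule.injective_subtype _) (Submodule.mkQ_surjective _) ?_ _ hcok hloc
      rw [LinearMap.exact_iff, Submodule.ker_mkQ, Submodule.range_subtype]
    refine V_mid I (LinearMap.ker f).subtype f.rangeRestrict
        (Submodule.injective_subtype _) (LinearMap.surjective_rangeRestrict f) ?_ _ hker hrange
    rw [LinearMap.exact_iff, Submodule.range_subtype, LinearMap.ker_rangeRestrict]

/-- cohomological dimension is bounded, uniformly -/
lemma exists_bound [IsNoetherianRing R] : ∃ N, ∀ i, N < i → ∀ (W : Type u)
    [AddCommGroup W] [Module R W], V I i (ModuleCat.of R W) := by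
  obtain ⟨s, hs⟩ := IsNoetherian.noetherian I
  refine ⟨s.toList.length, fun i hi W _ _ => V_bound I s.toList (fun x hx => ?_) W ?_ i hi⟩
  · rw [← hs]; exact Submodule.subset_span (by simpa using hx)
  · conv_lhs => rw [← hs]
    refine Ideal.span_mono (fun x hx => Or.inl (by simpa using hx))

end
end CD1

namespace CD1

open CategoryTheory CategoryTheory.Abelian CategoryTheory.Limits

section
variable {R : Type u} [CommRing R]

lemma opc_a (K : ChainComplex (ModuleCat.{u} R)ᵒᵖ ℕ) (n : ℕ) (x : (K.X n).unop)
    (hx : (K.d (n+1) n).unop.hom x = 0) :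
    ∃ z : (K.opcycles n).unop, (K.pOpcycles n).unop.hom z = x := by
  let S : ShortComplex (ModuleCat.{u} R)ᵒᵖ := ShortComplex.mk (K.d (n+1) n) (K.pOpcycles n) (by simp)
  have hS : S.Exact := S.exact_of_g_is_cokernel (K.opcyclesIsCokernel (n+1) n (by simp))
  exact (ShortComplex.moduleCat_exact_iff _).1 hS.unop x hx

lemma opc_inj (K : ChainComplex (ModuleCat.{u} R)ᵒᵖ ℕ) (n : ℕ) :
    Function.Injective (K.pOpcycles n).unop.hom :=
  (ModuleCat.mono_iff_injective _).1 inferInstance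

lemma hi_surj (K : ChainComplex (ModuleCat.{u} R)ᵒᵖ ℕ) (n : ℕ) :
    Function.Surjective (K.homologyι n).unop.hom :=
  (ModuleCat.epi_iff_surjective _).1 inferInstance

lemma opc_d (K : ChainComplex (ModuleCat.{u} R)ᵒᵖ ℕ) (n : ℕ) (z : (K.opcycles n).unop) :
    (K.d (n+1) n).unop.hom ((K.pOpcycles n).unop.hom z) = 0 := by
  have : (K.pOpcycles n).unop ≫ (K.d (n+1) n).unop = 0 := by
    rw [← unop_comp]; simp
  exact congrArg (fun f => f.hom z) this

lemma opc_b (K : ChainComplex (ModuleCat.{u} R)ᵒᵖ ℕ) (n : ℕ) (z : (K.opcycles (n+1)).unop) :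
    (K.homologyι (n+1)).unop.hom z = 0 ↔
      ∃ y : (K.X n).unop, (K.d (n+1) n).unop.hom y = (K.pOpcycles (n+1)).unop.hom z := by
  have h1 : (K.fromOpcycles (n+1) n).unop ≫ (K.pOpcycles (n+1)).unop = (K.d (n+1) n).unop := by
    rw [← unop_comp]; simp
  have h1' (y) : (K.pOpcycles (n+1)).unop.hom ((K.fromOpcycles (n+1) n).unop.hom y)
      = (K.d (n+1) n).unop.hom y := congrArg (fun f => f.hom y) h1
  let S : ShortComplex (ModuleCat.{u} R)ᵒᵖ :=
    ShortComplex.mk (K.homologyι (n+1)) (K.fromOpcycles (n+1) n) (by simp)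
  have hS : S.Exact := S.exact_of_f_is_kernel (K.homologyIsKernel (n+1) n (by simp))
  constructor
  · intro h
    obtain ⟨y, hy⟩ := (ShortComplex.moduleCat_exact_iff _).1 hS.unop z h
    exact ⟨y, (h1' y).symm.trans (congrArg _ hy)⟩
  · rintro ⟨y, hy⟩
    rw [← h1'] at hy
    rw [← opc_inj K _ hy]
    exact congrArg (fun f => f.hom y) S.unop.zero

lemma corr_aux {A W : ModuleCat.{u} R} (i : ℕ) (P : ProjectiveResolution A) :
    ∃ rep : ((P.complex.X (i+1)) ⟶ W) → (((Ext R (ModuleCat.{u} R) (i+1)).obj (Opposite.op A)).obj W)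
        → Prop,
      (∀ f x, rep f x → P.complex.d (i+2) (i+1) ≫ f = 0) ∧
      (∀ f, P.complex.d (i+2) (i+1) ≫ f = 0 → ∃ x, rep f x) ∧ (∀ x, ∃ f, rep f x) ∧
      (∀ f x, rep f x → ∀ (A' : ModuleCat.{u} R) (P' : ProjectiveResolution A') (φ : A' ⟶ A)
        (g : ProjectiveResolution.Hom P' P φ),
        ((((Ext R (ModuleCat.{u} R) (i+1)).map φ.op).app W).hom x = 0 ↔
          ∃ y, P'.complex.d (i+1) i ≫ y = g.hom.f (i+1) ≫ f)) := by
  let F : ModuleCat.{u} R ⥤ (ModuleCat.{u} R)ᵒᵖ := ((linearYoneda R (ModuleCat.{u} R)).obj W).rightOp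
  let K {A : ModuleCat.{u} R} (P : ProjectiveResolution A) : ChainComplex (ModuleCat.{u} R)ᵒᵖ ℕ :=
    (F.mapHomologicalComplex _).obj P.complex
  let r {A : ModuleCat.{u} R} (P : ProjectiveResolution A) :
      (F.leftDerived (i+1)).obj A ⟶ (K P).opcycles (i+1) :=
    (P.isoLeftDerivedObj F (i+1)).hom ≫ (K P).homologyι (i+1)
  have rsurj {A : ModuleCat.{u} R} (P : ProjectiveResolution A) :
      Function.Surjective (r P).unop.hom := by
    have h1 := hi_surj (K P) (i+1)
    have h2 : Function.Surjective (P.isoLeftDerivedObj F (i+1)).hom.unop.hom :=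
      (ModuleCat.epi_iff_surjective _).1 inferInstance
    exact h2.comp h1
  have rzero {A : ModuleCat.{u} R} (P : ProjectiveResolution A) (z : ((K P).opcycles (i+1)).unop) :
      (r P).unop.hom z = 0 ↔ ((K P).homologyι (i+1)).unop.hom z = 0 := by
    have : Function.Injective (P.isoLeftDerivedObj F (i+1)).hom.unop.hom :=
      (ModuleCat.mono_iff_injective _).1 inferInstance
    exact map_eq_zero_iff (P.isoLeftDerivedObj F (i+1)).hom.unop.hom this
  have rnat {A' : ModuleCat.{u} R} (P' : ProjectiveResolution A') (φ : A' ⟶ A)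
        (g : ProjectiveResolution.Hom P' P φ) :
        (F.leftDerived (i+1)).map φ ≫ r P = r P' ≫
          HomologicalComplex.opcyclesMap ((F.mapHomologicalComplex _).map g.hom) (i+1) := by
    have h := ProjectiveResolution.isoLeftDerivedObj_hom_naturality φ P' P g.hom
      g.hom_f_zero_comp_π_f_zero F (i+1)
    refine (Category.assoc _ _ _).symm.trans ((congrArg (fun t => t ≫ (K P).homologyι (i+1)) h).trans
      ((Category.assoc _ _ _).trans (Eq.trans ?_ (Category.assoc _ _ _).symm)))
    refine congrArg (fun t => (P'.isoLeftDerivedObj F (i+1)).hom ≫ t) ?_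
    exact HomologicalComplex.homologyι_naturality
      ((F.mapHomologicalComplex (ComplexShape.down ℕ)).map g.hom) (i+1)
  refine ⟨fun f x => ∃ z : ((K P).opcycles (i+1)).unop, ((K P).pOpcycles (i+1)).unop.hom z = f ∧
    (r P).unop.hom z = x, ?_, ?_, ?_, ?_⟩
  · rintro f x ⟨z, rfl, -⟩
    exact opc_d (K P) (i+1) z
  · intro f hf
    obtain ⟨z, hz⟩ := opc_a (K P) (i+1) f hf
    exact ⟨_, z, hz, rfl⟩
  · intro x
    obtain ⟨z, hz⟩ := rsurj P x
    exact ⟨_, z, rfl, hz⟩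
  · rintro f x ⟨z, rfl, rfl⟩ A' P' φ g
    have h1 := congrArg (fun (q : (F.leftDerived (i+1)).obj A' ⟶ (K P).opcycles (i+1)) =>
      q.unop.hom z) (rnat P' φ g)
    change ((F.leftDerived (i+1)).map φ).unop.hom ((r P).unop.hom z) = _ at h1
    change ((F.leftDerived (i+1)).map φ).unop.hom ((r P).unop.hom z) = 0 ↔ _
    rw [h1]
    refine (rzero P' _).trans ?_
    refine (opc_b (K P') i _).trans ?_
    have h2 := congrArg (fun (q : (K P').X (i+1) ⟶ (K P).opcycles (i+1)) => q.unop.hom z)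
      (HomologicalComplex.p_opcyclesMap ((F.mapHomologicalComplex _).map g.hom) (i+1))
    refine exists_congr fun y => ?_
    exact iff_of_eq (congrArg (fun t => ((K P').d (i+1) i).unop.hom y = t) h2)

lemma corr_old {A W : ModuleCat.{u} R} (i : ℕ)
    (x : ((Ext R (ModuleCat.{u} R) (i+1)).obj (Opposite.op A)).obj W) :
    ∃ α : Abelian.Ext A W (i+1), ∀ (A' : ModuleCat.{u} R) (φ : A' ⟶ A),
      (((Ext R (ModuleCat.{u} R) (i+1)).map φ.op).app W).hom x = 0 ↔
        (Ext.mk₀ φ).comp α (zero_add _) = 0 := by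
  let P := ProjectiveResolution.of A
  obtain ⟨rep, h1, h2, h3, h4⟩ := corr_aux (W := W) i P
  obtain ⟨f, hf⟩ := h3 x
  refine ⟨P.extMk f _ rfl (h1 _ _ hf), fun A' φ => ?_⟩
  let P' := ProjectiveResolution.of A'
  let g : ProjectiveResolution.Hom P' P φ :=
    { hom := ProjectiveResolution.lift φ P' P
      hom_f_zero_comp_π_f_zero := ProjectiveResolution.lift_commutes_zero φ P' P }
  rw [h4 f x hf A' P' φ g, ProjectiveResolution.mk₀_comp_extMk _ _ _ _ g,
    ProjectiveResolution.extMk_eq_zero_iff _ _ _ _ _ i rfl]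

lemma corr_new {A W : ModuleCat.{u} R} (i : ℕ) (α : Abelian.Ext A W (i+1)) :
    ∃ x : ((Ext R (ModuleCat.{u} R) (i+1)).obj (Opposite.op A)).obj W,
      ∀ (A' : ModuleCat.{u} R) (φ : A' ⟶ A),
      (((Ext R (ModuleCat.{u} R) (i+1)).map φ.op).app W).hom x = 0 ↔
        (Ext.mk₀ φ).comp α (zero_add _) = 0 := by
  let P := ProjectiveResolution.of A
  obtain ⟨rep, h1, h2, h3, h4⟩ := corr_aux (W := W) i P
  obtain ⟨f, hf0, rfl⟩ := P.extMk_surjective α _ rfl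
  obtain ⟨x, hf⟩ := h2 f hf0
  refine ⟨x, fun A' φ => ?_⟩
  let P' := ProjectiveResolution.of A'
  let g : ProjectiveResolution.Hom P' P φ :=
    { hom := ProjectiveResolution.lift φ P' P
      hom_f_zero_comp_π_f_zero := ProjectiveResolution.lift_commutes_zero φ P' P }
  rw [h4 f x hf A' P' φ g, ProjectiveResolution.mk₀_comp_extMk _ _ _ _ g,
    ProjectiveResolution.extMk_eq_zero_iff _ _ _ _ _ i rfl]

end
end CD1

namespace CD1

open CategoryTheory CategoryTheory.Abelian CategoryTheory.Limits

section
variable {R : Type u} [CommRing R] (I : Ideal R)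

lemma bridge (i : ℕ) (W : ModuleCat.{u} R) :
    Subsingleton (LC R I (i+1) W) ↔ V I (i+1) W := by
  let G := localCohomology.diagram (localCohomology.idealPowersDiagram I) (i+1)
  let ev := (evaluation (ModuleCat.{u} R) (ModuleCat.{u} R)).obj W
  have hc : IsColimit (ev.mapCocone (colimit.cocone G)) :=
    isColimitOfPreserves ev (colimit.isColimit G)
  have : PreservesFilteredColimitsOfSize.{0, 0} (forget (ModuleCat.{u} R)) :=
    preservesSmallestFilteredColimits_of_preservesFilteredColimits.{u, u} _
  have : PreservesColimitsOfShape (ℕᵒᵖ)ᵒᵖ (forget (ModuleCat.{u} R)) :=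
    PreservesFilteredColimitsOfSize.preserves_filtered_colimits _
  let D := ev.mapCocone (colimit.cocone G)
  have e1 : Subsingleton (LC R I (i+1) W) ↔ ∀ x : D.pt, x = 0 :=
    ⟨fun h x => h.elim x 0, fun h => ⟨fun a b => (h a).trans (h b).symm⟩⟩
  rw [e1]
  have rep := Concrete.isColimit_exists_rep (G ⋙ ev) hc
  have zer (j) (x : (G ⋙ ev).obj j) : D.ι.app j x = 0 ↔ ∃ k, ∃ f : j ⟶ k, (G ⋙ ev).map f x = 0 := by
    constructor
    · intro h
      obtain ⟨k, f, g, h'⟩ := Concrete.isColimit_exists_of_rep_eq (G ⋙ ev) hc x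
        (0 : (G ⋙ ev).obj j) (h.trans (map_zero (D.ι.app j).hom).symm)
      exact ⟨k, f, h'.trans (map_zero ((G ⋙ ev).map g).hom)⟩
    · rintro ⟨k, f, h⟩
      have := congrArg (fun q => q.hom x) (D.w f)
      refine this.symm.trans ?_
      exact (congrArg (D.ι.app k).hom h).trans (map_zero (D.ι.app k).hom)
  have mapeq {n m : ℕ} (h : n ≤ m) (f : (Opposite.op (Opposite.op n) : ℕᵒᵖᵒᵖ) ⟶ Opposite.op (Opposite.op m)) :
      (G ⋙ ev).map f = (((Ext R (ModuleCat.{u} R) (i+1)).map (tr I h).op).app W) := rfl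
  constructor
  · intro h n α
    obtain ⟨x, hx⟩ := corr_new i α
    obtain ⟨k, f, hf⟩ := (zer (Opposite.op (Opposite.op n)) x).1 (h _)
    have hnk : n ≤ k.unop.unop := f.unop.unop.down.down
    exact ⟨k.unop.unop, hnk, (hx _ (tr I hnk)).1 hf⟩
  · intro h x
    obtain ⟨j, x, rfl⟩ := rep x
    obtain ⟨α, hα⟩ := corr_old i (A := Qt I j.unop.unop) (W := W) x
    obtain ⟨m, hm, h0⟩ := h j.unop.unop α
    refine (zer j x).2 ⟨Opposite.op (Opposite.op m), (homOfLE hm).op.op, ?_⟩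
    exact (hα _ (tr I hm)).2 h0

end
end CD1

namespace CD1

open CategoryTheory CategoryTheory.Limits MonoidalCategory TensorProduct

section
variable {R : Type u} [CommRing R]

structure Res (M : ModuleCat.{u} R) where
  Q : ℕ → ModuleCat.{u} R
  flat : ∀ n, Module.Flat R (Q n)
  d : ∀ n, Q (n+1) →ₗ[R] Q n
  π : Q 0 →ₗ[R] M
  surj : Function.Surjective π
  ex0 : Function.Exact (d 0) π
  ex : ∀ n, Function.Exact (d (n+1)) (d n)
  tor : ∀ (A : Type u) [AddCommGroup A] [Module R A] (i : ℕ),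
    Subsingleton (TorMod R (i+1) (ModuleCat.of R A) M) ↔
      Function.Exact ((d (i+1)).lTensor A) ((d i).lTensor A)

lemma exists_res (M : ModuleCat.{u} R) : Nonempty (Res M) := by
  let P := ProjectiveResolution.of M
  refine ⟨⟨fun n => P.complex.X n, fun n => ?_, fun n => (P.complex.d (n+1) n).hom, (P.π.f 0).hom,
    ?_, ?_, ?_, ?_⟩⟩
  · have : Module.Projective R (P.complex.X n) :=
      (IsProjective.iff_projective _).2 (P.projective n)
    infer_instance
  · exact (ModuleCat.epi_iff_surjective _).1 (inferInstanceAs (Epi (P.π.f 0)))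
  · exact (ShortComplex.ShortExact.moduleCat_exact_iff_function_exact _).1 P.exact₀
  · intro n
    exact (ShortComplex.ShortExact.moduleCat_exact_iff_function_exact _).1 (P.exact_succ n)
  · intro A _ _ i
    let F := (tensoringLeft (ModuleCat.{u} R)).obj (ModuleCat.of R A)
    rw [← ModuleCat.isZero_iff_subsingleton]
    refine (Iso.isZero_iff (P.isoLeftDerivedObj F (i+1))).trans ?_
    refine (HomologicalComplex.exactAt_iff_isZero_homology
      ((F.mapHomologicalComplex (ComplexShape.down ℕ)).obj P.complex) (i+1)).symm.trans ?_
    rw [HomologicalComplex.exactAt_iff' _ (i+2) (i+1) i (by simp) (by simp)]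
    exact (ShortComplex.ShortExact.moduleCat_exact_iff_function_exact _)

lemma tor_zero (A : Type u) [AddCommGroup A] [Module R A] (M : ModuleCat.{u} R) :
    Subsingleton (TorMod R 0 (ModuleCat.of R A) M) ↔ Subsingleton (A ⊗[R] M) := by
  let F := (tensoringLeft (ModuleCat.{u} R)).obj (ModuleCat.of R A)
  have : PreservesFiniteColimits F :=
    inferInstanceAs (PreservesFiniteColimits (tensorLeft (ModuleCat.of R A)))
  rw [← ModuleCat.isZero_iff_subsingleton]
  refine (Iso.isZero_iff (F.leftDerivedZeroIsoSelf.app M)).trans ?_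
  exact ModuleCat.isZero_iff_subsingleton

lemma comm_lr {A B X Y : Type u} [AddCommGroup A] [AddCommGroup B]
    [AddCommGroup X] [Module R A] [Module R B] [Module R X] [AddCommGroup Y] [Module R Y]
    (f : A →ₗ[R] B) (d : X →ₗ[R] Y) (z : A ⊗[R] X) :
    f.rTensor Y (d.lTensor A z) = d.lTensor B (f.rTensor X z) := by
  rw [← LinearMap.comp_apply, ← LinearMap.comp_apply, LinearMap.rTensor_comp_lTensor,
    LinearMap.lTensor_comp_rTensor]

section chase
variable {A F C : Type u} [AddCommGroup A] [AddCommGroup F]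
    [AddCommGroup C] [Module R A] [Module R F] [Module R C] (f : A →ₗ[R] F) (g : F →ₗ[R] C)
    (hf : Function.Injective f) (hg : Function.Surjective g) (h : Function.Exact f g)
include hf hg h

lemma chase {Q2 Q1 Q0 : Type u} [AddCommGroup Q2] [AddCommGroup Q1] [AddCommGroup Q0]
    [Module R Q2] [Module R Q1] [Module R Q0] [Module.Flat R Q0]
    (d2 : Q2 →ₗ[R] Q1) (d1 : Q1 →ₗ[R] Q0) (hd : d1 ∘ₗ d2 = 0)
    (hC : Function.Exact (d2.lTensor C) (d1.lTensor C)) (x : A ⊗[R] Q0) (y : F ⊗[R] Q1)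
    (hxy : f.rTensor Q0 x = d1.lTensor F y) : ∃ x1, d1.lTensor A x1 = x := by
  have hz : ∀ X : Type u, ∀ [AddCommGroup X] [Module R X], Function.Exact (f.rTensor X) (g.rTensor X) :=
    fun X _ _ => rTensor_exact X h hg
  have h1 : d1.lTensor C (g.rTensor Q1 y) = 0 := by
    rw [← comm_lr, ← hxy, (hz Q0).apply_apply_eq_zero]
  obtain ⟨z'', hz''⟩ := (hC _).1 h1
  obtain ⟨z, rfl⟩ := LinearMap.rTensor_surjective Q2 hg z''
  have h2 : g.rTensor Q1 (y - d2.lTensor F z) = 0 := by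
    rw [map_sub, comm_lr, hz'', sub_self]
  obtain ⟨x1, hx1⟩ := (hz Q1 _).1 h2
  refine ⟨x1, Module.Flat.rTensor_preserves_injective_linearMap (M := Q0) f hf ?_⟩
  rw [comm_lr, hx1, map_sub, ← LinearMap.comp_apply, ← LinearMap.lTensor_comp, hd, hxy]
  simp

variable {M : ModuleCat.{u} R}

lemma T1 (h1 : Subsingleton (TorMod R 1 (ModuleCat.of R C) M)) :
    Function.Injective (f.rTensor M) := by
  obtain ⟨P⟩ := exists_res M
  have := P.flat
  rw [injective_iff_map_eq_zero]
  intro u hu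
  obtain ⟨x, rfl⟩ := LinearMap.lTensor_surjective A P.surj u
  rw [comm_lr] at hu
  obtain ⟨y, hy⟩ := (lTensor_exact F P.ex0 P.surj _).1 hu
  obtain ⟨x1, rfl⟩ := chase f g hf hg h (P.d 1) (P.d 0) (P.ex 0).linearMap_comp_eq_zero
    ((P.tor C 0).1 h1) x y hy.symm
  exact (lTensor_exact A P.ex0 P.surj).apply_apply_eq_zero _

lemma T2 [Module.Flat R F] (i : ℕ) (h1 : Subsingleton (TorMod R (i+2) (ModuleCat.of R C) M)) :
    Subsingleton (TorMod R (i+1) (ModuleCat.of R A) M) := by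
  obtain ⟨P⟩ := exists_res M
  have := P.flat
  rw [P.tor]
  intro x
  constructor
  · intro hx
    have : (P.d i).lTensor F (f.rTensor _ x) = 0 := by rw [← comm_lr, hx, map_zero]
    obtain ⟨y, hy⟩ := (Module.Flat.lTensor_exact F (P.ex i) _).1 this
    exact chase f g hf hg h (P.d (i+2)) (P.d (i+1)) (P.ex _).linearMap_comp_eq_zero
      ((P.tor C (i+1)).1 h1) x y hy.symm
  · rintro ⟨y, rfl⟩
    rw [← LinearMap.comp_apply, ← LinearMap.lTensor_comp, (P.ex _).linearMap_comp_eq_zero]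
    simp

lemma T3 [Module.Flat R F] (h1 : Function.Injective (f.rTensor M)) :
    Subsingleton (TorMod R 1 (ModuleCat.of R C) M) := by
  obtain ⟨P⟩ := exists_res M
  have := P.flat
  have hz : ∀ X : Type u, ∀ [AddCommGroup X] [Module R X], Function.Exact (f.rTensor X) (g.rTensor X) :=
    fun X _ _ => rTensor_exact X h hg
  rw [P.tor]
  intro x
  constructor
  · intro hx
    obtain ⟨x, rfl⟩ := LinearMap.rTensor_surjective _ hg x
    rw [← comm_lr] at hx
    obtain ⟨w, hw⟩ := (hz _ _).1 hx
    have h2 : P.π.lTensor A w = 0 := by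
      apply h1
      rw [comm_lr, hw, (lTensor_exact F P.ex0 P.surj).apply_apply_eq_zero, map_zero]
    obtain ⟨v, rfl⟩ := (lTensor_exact A P.ex0 P.surj _).1 h2
    have h3 : (P.d 0).lTensor F (x - f.rTensor _ v) = 0 := by
      rw [map_sub, ← hw, comm_lr, sub_self]
    obtain ⟨t, ht⟩ := (Module.Flat.lTensor_exact F (P.ex 0) _).1 h3
    refine ⟨g.rTensor _ t, ?_⟩
    rw [← comm_lr, ht, map_sub, (hz _).apply_apply_eq_zero, sub_zero]
  · rintro ⟨y, rfl⟩
    rw [← LinearMap.comp_apply, ← LinearMap.lTensor_comp, (P.ex _).linearMap_comp_eq_zero]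
    simp
end chase

end
end CD1

namespace CD1

open CategoryTheory CategoryTheory.Abelian

section
variable {R : Type u} [CommRing R] (I : Ideal R)

lemma V_fin [IsNoetherianRing R] (i : ℕ) (h : V I (i+1) (ModuleCat.of R R)) (n : ℕ) :
    V I (i+1) (ModuleCat.of R (Fin n → R)) := by
  induction n with
  | zero => exact V_tors I i _ (fun w => ⟨0, fun a _ => Subsingleton.elim _ _⟩)
  | succ n ih =>
    refine V_mid I (LinearMap.single R (fun _ : Fin (n+1) => R) 0)
      (LinearMap.funLeft R R (Fin.succ : Fin n → Fin (n+1))) ?_ ?_ ?_ _ h ih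
    · exact Pi.single_injective (M := fun _ : Fin (n+1) => R) 0
    · intro x
      exact ⟨Fin.cons 0 x, by ext j; simp [LinearMap.funLeft_apply]⟩
    · intro x
      constructor
      · intro hx
        refine ⟨x 0, ?_⟩
        ext j
        refine Fin.cases ?_ (fun j => ?_) j
        · simp
        · have := congrFun hx j
          simp [LinearMap.funLeft_apply] at this ⊢
          exact this.symm
      · rintro ⟨y, rfl⟩
        ext j
        simp [LinearMap.funLeft_apply]

lemma V_fg [IsNoetherianRing R] (h : ∀ i, 2 ≤ i → V I i (ModuleCat.of R R)) (i : ℕ) (hi : 2 ≤ i)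
    (W : Type u) [AddCommGroup W] [Module R W] [Module.Finite R W] :
    V I i (ModuleCat.of R W) := by
  obtain ⟨N, hN⟩ := exists_bound I
  suffices H : ∀ k i, 2 ≤ i → N < i + k → ∀ (W : Type u) [AddCommGroup W] [Module R W]
      [Module.Finite R W], V I i (ModuleCat.of R W) from H (N+1) i hi (by omega) W
  intro k
  induction k with
  | zero => intro i _ h W _ _ _; exact hN i (by omega) W
  | succ k ih =>
    intro i hi hk W _ _ _
    obtain ⟨n, g, hg⟩ := Module.Finite.exists_fin' R W
    obtain ⟨j, rfl⟩ : ∃ j, i = j + 1 := ⟨i - 1, by omega⟩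
    exact V_right I (LinearMap.ker g).subtype g (Subtype.val_injective) hg
      (LinearMap.exact_subtype_ker_map g) (j+1) (V_fin I j (h _ hi) n)
      (ih _ (by omega) (by omega) _)

lemma lift_abs {S₁ S₂ T : ShortComplex (ModuleCat.{u} R)} (h₁ : S₁.ShortExact)
    (h₂ : S₂.ShortExact) (hT : T.ShortExact) (f : S₁ ⟶ S₂) (ι : S₂.X₁ ⟶ T.X₃)
    [Projective S₁.X₂]
    (h : (Ext.mk₀ f.τ₃).comp (h₂.extClass.comp ((Ext.mk₀ ι).comp hT.extClass (zero_add 1))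
      (rfl : 1 + 1 = 2)) (zero_add 2) = 0) :
    ∃ φ : S₁.X₁ ⟶ T.X₂, φ ≫ T.g = f.τ₁ ≫ ι := by
  rw [← Ext.comp_assoc (h₁₂ := zero_add 1) (h₂₃ := (rfl : 1 + 1 = 2)) (h := by omega),
    ← ShortComplex.ShortExact.extClass_naturality h₁ h₂ f,
    Ext.comp_assoc_of_second_deg_zero, Ext.mk₀_comp_mk₀_assoc] at h
  obtain ⟨x₂, hx₂⟩ := Ext.contravariant_sequence_exact₁ (hS := h₁) _ _ _ h
  rw [Ext.eq_zero_of_projective x₂, Ext.comp_zero] at hx₂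
  obtain ⟨y, hy⟩ := Ext.covariant_sequence_exact₃ (hS := hT) _ _ _ hx₂.symm
  obtain ⟨φ, rfl⟩ := (Ext.mk₀_bijective _ _).2 y
  rw [Ext.mk₀_comp_mk₀] at hy
  exact ⟨φ, (Ext.mk₀_bijective _ _).1 hy⟩

lemma lift_pow {K F : Type u} [AddCommGroup K] [AddCommGroup F] [Module R K] [Module R F]
    (f : K →ₗ[R] F) (g : F →ₗ[R] I) (hf : Function.Injective f) (hg : Function.Surjective g)
    (hfg : Function.Exact f g) (hK : V I 2 (ModuleCat.of R K)) :
    ∃ m, ∃ φ : (I ^ m : Ideal R) →ₗ[R] F, ∀ a, (g (φ a) : R) = a := by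
  have hS : ∀ m, (ShortComplex.moduleCatMk (I ^ m : Ideal R).subtype (I ^ m : Ideal R).mkQ
      (LinearMap.exact_subtype_mkQ _).linearMap_comp_eq_zero).ShortExact := fun m =>
    ses _ _ Subtype.val_injective (Submodule.mkQ_surjective _) (LinearMap.exact_subtype_mkQ _)
  have hT := ses f g hf hg hfg
  let ι : ModuleCat.of R (I ^ 1 : Ideal R) ⟶ ModuleCat.of R I :=
    ModuleCat.ofHom (Submodule.inclusion (pow_one I).le)
  obtain ⟨m, hm, h⟩ := hK 1 ((hS 1).extClass.comp ((Ext.mk₀ ι).comp hT.extClass (zero_add 1))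
      (rfl : 1 + 1 = 2))
  let fm : ShortComplex.moduleCatMk (I ^ m : Ideal R).subtype (I ^ m : Ideal R).mkQ
      (LinearMap.exact_subtype_mkQ _).linearMap_comp_eq_zero ⟶
      ShortComplex.moduleCatMk (I ^ 1 : Ideal R).subtype (I ^ 1 : Ideal R).mkQ
      (LinearMap.exact_subtype_mkQ _).linearMap_comp_eq_zero :=
    { τ₁ := ModuleCat.ofHom (Submodule.inclusion (Ideal.pow_le_pow_right hm))
      τ₂ := 𝟙 _
      τ₃ := tr I hm
      comm₁₂ := by ext; rfl
      comm₂₃ := by ext; rfl }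
  have : Projective (ShortComplex.moduleCatMk (I ^ m : Ideal R).subtype (I ^ m : Ideal R).mkQ
      (LinearMap.exact_subtype_mkQ _).linearMap_comp_eq_zero).X₂ :=
    (IsProjective.iff_projective R).1 inferInstance
  obtain ⟨φ, hφ⟩ := lift_abs (hS m) (hS 1) hT fm ι h
  refine ⟨m, φ.hom, fun a => ?_⟩
  have := congrArg (fun k => ((k.hom a : I) : R)) hφ
  exact this

end
end CD1

namespace CD1

open CategoryTheory CategoryTheory.Limits MonoidalCategory TensorProduct

section
variable {R : Type u} [CommRing R] (I : Ideal R)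

lemma tor_vanish (i : ℕ) (M : ModuleCat.{u} R) {s : ℕ} (x : Fin s → R) (hx : ∀ j, x j ∈ I)
    (φ : Fin s → (M →ₗ[R] M)) (h : ∀ m, ∑ j, x j • φ j m = m) :
    Subsingleton (TorMod R i (ModuleCat.of R (R ⧸ I)) M) := by
  rw [← ModuleCat.isZero_iff_subsingleton]
  let F := (tensoringLeft (ModuleCat.{u} R)).obj (ModuleCat.of R (R ⧸ I))
  let P := ProjectiveResolution.of M
  have hF : ∀ (x : R), x ∈ I → ∀ N : ModuleCat.{u} R, F.map (x • 𝟙 N) = 0 := by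
    intro x hx N
    apply ModuleCat.hom_ext
    refine TensorProduct.ext' (fun a n => ?_)
    change a ⊗ₜ[R] (x • n) = 0
    rw [← TensorProduct.smul_tmul]
    obtain ⟨r, rfl⟩ := Submodule.Quotient.mk_surjective _ a
    rw [← Submodule.Quotient.mk_smul, (Submodule.Quotient.mk_eq_zero I).2, zero_tmul]
    rw [smul_eq_mul, mul_comm]
    exact I.mul_mem_left _ hx
  let sm : R → (P.complex ⟶ P.complex) := fun x =>
    { f := fun n => x • 𝟙 _
      comm' := fun i j _ => by simp }
  have hsm : ∀ x, sm x ≫ P.π = P.π ≫ (ChainComplex.single₀ _).map (x • 𝟙 M) := by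
    intro x
    ext1
    rw [HomologicalComplex.comp_f, HomologicalComplex.comp_f, ChainComplex.single₀_map_f_zero]
    change (x • 𝟙 (P.complex.X 0)) ≫ P.π.f 0 = _
    rw [Linear.smul_comp, Category.id_comp]
    exact ((Linear.comp_smul (R := R) (P.complex.X 0) M M (P.π.f 0) x (𝟙 M)).trans
      (congrArg _ (Category.comp_id _))).symm
  let l := fun j => ProjectiveResolution.lift (ModuleCat.ofHom (φ j)) P P
  have hl : ∀ j, l j ≫ P.π = P.π ≫ (ChainComplex.single₀ _).map (ModuleCat.ofHom (φ j)) := fun j =>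
    ProjectiveResolution.lift_commutes _ _ _
  have h1 : 𝟙 M = ∑ j, ModuleCat.ofHom (φ j) ≫ (x j • 𝟙 M) := by
    apply ModuleCat.hom_ext
    apply LinearMap.ext
    intro m
    rw [ModuleCat.hom_sum, LinearMap.sum_apply]
    exact (h m).symm
  let g : P.complex ⟶ P.complex := ∑ j, l j ≫ sm (x j)
  have w : g ≫ P.π = P.π ≫ (ChainComplex.single₀ _).map (𝟙 M) := by
    have : (ChainComplex.single₀ (ModuleCat.{u} R)).Additive :=
      inferInstanceAs (HomologicalComplex.single _ _ _).Additive
    rw [h1, Functor.map_sum, Preadditive.comp_sum, Preadditive.sum_comp]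
    refine Finset.sum_congr rfl (fun j _ => ?_)
    rw [Category.assoc, hsm, ← Category.assoc, hl, Category.assoc, Functor.map_comp]
  have hg : (F.mapHomologicalComplex (ComplexShape.down ℕ)).map g = 0 := by
    rw [Functor.map_sum]
    refine Finset.sum_eq_zero (fun j _ => ?_)
    rw [Functor.map_comp]
    have : (F.mapHomologicalComplex (ComplexShape.down ℕ)).map (sm (x j)) = 0 := by
      ext1 n
      exact hF _ (hx j) _
    rw [this, comp_zero]
  have h2 : 𝟙 ((F.leftDerived i).obj M) = 0 := by
    rw [← (F.leftDerived i).map_id, Functor.leftDerived_map_eq F i (𝟙 M) g w,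
      Functor.comp_map, hg, Functor.map_zero, zero_comp, comp_zero]
  exact (IsZero.iff_id_eq_zero ((F.leftDerived i).obj M)).2 h2

variable (M : Type u) [AddCommGroup M] [Module R M]

def mu (J : Ideal R) : J ⊗[R] M →ₗ[R] M :=
  TensorProduct.lift ((LinearMap.lsmul R M).comp J.subtype)

@[simp] lemma mu_tmul (J : Ideal R) (a : J) (m : M) : mu M J (a ⊗ₜ m) = (a : R) • m := rfl

def mulm (J K : Ideal R) : J ⊗[R] K →ₗ[R] (J * K : Ideal R) :=
  TensorProduct.lift (LinearMap.mk₂ R (fun a b => ⟨(a : R) * b, Ideal.mul_mem_mul a.2 b.2⟩)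
    (fun _ _ _ => Subtype.ext (add_mul _ _ _)) (fun _ _ _ => Subtype.ext (smul_mul_assoc _ _ _))
    (fun _ _ _ => Subtype.ext (mul_add _ _ _)) (fun _ _ _ => Subtype.ext (mul_smul_comm _ _ _)))

lemma mulm_tmul (J K : Ideal R) (a : J) (b : K) : (mulm J K (a ⊗ₜ b) : R) = a * b := rfl

lemma mulm_surj (J K : Ideal R) : Function.Surjective (mulm J K) := by
  rintro ⟨c, hc⟩
  suffices H : ∃ t, (mulm J K t : R) = c by
    obtain ⟨t, ht⟩ := H
    exact ⟨t, Subtype.ext ht⟩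
  refine Submodule.mul_induction_on hc (fun a ha b hb => ?_) (fun a b ha hb => ?_)
  · exact ⟨(⟨a, ha⟩ : J) ⊗ₜ (⟨b, hb⟩ : K), rfl⟩
  · obtain ⟨t, rfl⟩ := ha
    obtain ⟨t', rfl⟩ := hb
    exact ⟨t + t', by simp⟩

lemma mu_mul (J K : Ideal R) (hJ : Function.Bijective (mu M J))
    (hK : Function.Bijective (mu M K)) : Function.Bijective (mu M (J * K)) := by
  let p : J ⊗[R] (K ⊗[R] M) →ₗ[R] (J * K : Ideal R) ⊗[R] M :=
    (mulm J K).rTensor M ∘ₗ (TensorProduct.assoc R J K M).symm.toLinearMap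
  have hp : Function.Surjective p :=
    (LinearMap.rTensor_surjective M (mulm_surj J K)).comp (LinearEquiv.surjective _)
  let q : J ⊗[R] (K ⊗[R] M) ≃ₗ[R] M :=
    (LinearEquiv.lTensor J (LinearEquiv.ofBijective _ hK)).trans (LinearEquiv.ofBijective _ hJ)
  have hc : ∀ t, mu M (J * K) (p t) = q t := by
    intro t
    have : mu M (J * K) ∘ₗ p = q.toLinearMap := by
      ext a b m
      simp [p, q, mulm_tmul, mul_smul]
      try exact smul_comm _ _ _
    exact LinearMap.congr_fun this t
  constructor
  · intro u v huv
    obtain ⟨u, rfl⟩ := hp u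
    obtain ⟨v, rfl⟩ := hp v
    rw [hc, hc] at huv
    rw [q.injective huv]
  · intro m
    obtain ⟨t, rfl⟩ := q.surjective m
    exact ⟨p t, hc t⟩

lemma mu_pow (h : Function.Bijective (mu M I)) (n : ℕ) : Function.Bijective (mu M (I ^ n)) := by
  induction n with
  | zero =>
    have h1 : (1 : R) ∈ I ^ 0 := by simp
    refine Function.bijective_iff_has_inverse.2 ⟨fun m => (⟨1, h1⟩ : (I ^ 0 : Ideal R)) ⊗ₜ m, ?_, ?_⟩
    · intro t
      induction t with
      | zero => simp
      | add u v hu hv => simp only [map_add, tmul_add] at hu hv ⊢; rw [hu, hv]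
      | tmul a m =>
        simp only [mu_tmul]
        rw [← TensorProduct.smul_tmul]
        congr 1
        ext
        simp
    · intro m
      simp
  | succ n ih => rw [pow_succ]; exact mu_mul M _ _ ih h

lemma fwd [IsNoetherianRing R] (h : ∀ i, 2 ≤ i → V I i (ModuleCat.of R R)) (M : ModuleCat.{u} R)
    (h0 : Subsingleton (TorMod R 0 (ModuleCat.of R (R ⧸ I)) M))
    (h1 : Subsingleton (TorMod R 1 (ModuleCat.of R (R ⧸ I)) M)) (i : ℕ) :
    Subsingleton (TorMod R i (ModuleCat.of R (R ⧸ I)) M) := by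
  obtain ⟨s, g, hg⟩ := Module.Finite.exists_fin' R I
  obtain ⟨m, φ, hφ⟩ := lift_pow I (LinearMap.ker g).subtype g Subtype.val_injective hg
    (LinearMap.exact_subtype_ker_map g) (V_fg I h 2 le_rfl _)
  have hinj : Function.Injective (I.subtype.rTensor M) :=
    T1 I.subtype I.mkQ Subtype.val_injective (Submodule.mkQ_surjective _)
      (LinearMap.exact_subtype_mkQ _) h1
  rw [tor_zero] at h0
  have hmu : ∀ t, mu M I t = TensorProduct.lid R M (I.subtype.rTensor M t) := by
    intro t
    have : mu M I = (TensorProduct.lid R M).toLinearMap ∘ₗ (I.subtype.rTensor M) := by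
      ext; simp
    exact LinearMap.congr_fun this t
  have hb : Function.Bijective (mu M I) := by
    constructor
    · intro u v huv
      rw [hmu, hmu] at huv
      exact hinj ((TensorProduct.lid R M).injective huv)
    · intro y
      obtain ⟨t, ht⟩ := (rTensor_exact M (LinearMap.exact_subtype_mkQ I)
        (Submodule.mkQ_surjective _) ((1 : R) ⊗ₜ y)).1 (Subsingleton.elim _ _)
      exact ⟨t, by rw [hmu, ht]; simp⟩
  let e := LinearEquiv.ofBijective _ (mu_pow I M hb m)
  let ψ : Fin s → ((I ^ m : Ideal R) ⊗[R] M →ₗ[R] M) := fun j =>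
    TensorProduct.lift ((LinearMap.lsmul R M).comp (LinearMap.proj j ∘ₗ φ))
  refine tor_vanish I i M (fun j => (g (Pi.single j 1) : R)) (fun j => (g _).2)
    (fun j => ψ j ∘ₗ e.symm.toLinearMap) (fun y => ?_)
  obtain ⟨t, rfl⟩ := e.surjective y
  have hsum : ∑ j, (g (Pi.single j 1) : R) • ψ j = mu M (I ^ m) := by
    ext a y
    simp only [ψ, LinearMap.sum_apply, LinearMap.smul_apply, AlgebraTensorModule.curry_apply,
      curry_apply, LinearMap.coe_restrictScalars, lift.tmul, LinearMap.comp_apply,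
      LinearMap.lsmul_apply, mu_tmul, LinearMap.proj_apply, smul_smul, ← Finset.sum_smul]
    congr 1
    rw [← hφ a]
    conv_rhs => rw [LinearMap.pi_apply_eq_sum_univ g (φ a)]
    simp only [Submodule.coe_sum, Submodule.coe_smul, smul_eq_mul]
    refine Finset.sum_congr rfl (fun j _ => ?_)
    rw [mul_comm]
    congr 3
    congr 1
    ext k
    simp [Pi.single_apply, eq_comm]
  have := LinearMap.congr_fun hsum t
  have he : e t = mu M (I ^ m) t := rfl
  rw [he]
  simpa [← he] using this

end
end CD1

namespace CD1

open TensorProduct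

section
variable {R : Type u} [CommRing R] (D : Type u) [AddCommGroup D] [Module R D]

def theta (A : Type u) [AddCommGroup A] [Module R A] :
    A ⊗[R] CharacterModule D →ₗ[R] CharacterModule (A →ₗ[R] D) :=
  TensorProduct.lift (LinearMap.mk₂ R
    (fun a c => CharacterModule.dual (LinearMap.applyₗ (R := R) (M₂ := D) a) c)
    (fun a a' c => by ext h; exact (congrArg c (map_add h a a')).trans (map_add c (h a) (h a')))
    (fun r a c => by ext h; exact congrArg c (map_smul h r a))
    (fun a c c' => map_add _ c c')
    (fun r a c => map_smul (CharacterModule.dual (LinearMap.applyₗ (R := R) (M₂ := D) a)) r c))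

lemma theta_tmul (A : Type u) [AddCommGroup A] [Module R A] (a : A) (c : CharacterModule D)
    (h : A →ₗ[R] D) : theta D A (a ⊗ₜ c) h = c (h a) := rfl

lemma theta_nat {A B : Type u} [AddCommGroup A] [Module R A] [AddCommGroup B] [Module R B]
    (f : A →ₗ[R] B) (z : A ⊗[R] CharacterModule D) :
    theta D B (f.rTensor _ z) = CharacterModule.dual (LinearMap.lcomp R D f) (theta D A z) := by
  have : theta D B ∘ₗ f.rTensor _ = CharacterModule.dual (LinearMap.lcomp R D f) ∘ₗ theta D A := by
    ext a c h
    rfl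
  exact LinearMap.congr_fun this z

lemma sum_form {n : ℕ} {M : Type u} [AddCommGroup M] [Module R M] (t : (Fin n → R) ⊗[R] M) :
    ∃ c : Fin n → M, t = ∑ j, (Pi.single j (1 : R) : Fin n → R) ⊗ₜ[R] c j := by
  induction t with
  | zero => exact ⟨0, by simp⟩
  | add u v hu hv =>
    obtain ⟨c, rfl⟩ := hu
    obtain ⟨c', rfl⟩ := hv
    exact ⟨c + c', by simp [tmul_add, Finset.sum_add_distrib]⟩
  | tmul a m =>
    refine ⟨fun j => a j • m, ?_⟩
    simp_rw [← TensorProduct.smul_tmul, ← TensorProduct.sum_tmul]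
    congr 1
    ext k
    simp [Finset.sum_apply, Pi.single_apply]

lemma theta_fin_inj (n : ℕ) : Function.Injective (theta (R := R) D (Fin n → R)) := by
  rw [injective_iff_map_eq_zero]
  intro t ht
  obtain ⟨c, rfl⟩ := sum_form t
  refine Finset.sum_eq_zero (fun k _ => ?_)
  suffices c k = 0 by rw [this, tmul_zero]
  ext d
  have h1 := DFunLike.congr_fun ht ((LinearMap.proj k : (Fin n → R) →ₗ[R] R).smulRight d)
  rw [map_sum] at h1
  have h2 : ∀ (s : Finset (Fin n)) (f : Fin n → CharacterModule ((Fin n → R) →ₗ[R] D)) h,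
      (∑ j ∈ s, f j) h = ∑ j ∈ s, f j h := by
    intro s f h
    exact AddMonoidHom.finsetSum_apply (f : Fin n → (((Fin n → R) →ₗ[R] D) →+ AddCircle (1 : ℚ))) s h
  rw [h2] at h1
  rw [Finset.sum_eq_single k] at h1
  · change c k d = (0 : AddCircle (1 : ℚ))
    simpa [theta_tmul] using h1.trans (show _ = (0 : AddCircle (1 : ℚ)) from rfl)
  · intro j _ hj
    rw [theta_tmul]
    simp [Pi.single_apply, hj.symm]
  · simp

lemma theta_fin_surj (n : ℕ) : Function.Surjective (theta (R := R) D (Fin n → R)) := by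
  intro χ
  let c : Fin n → CharacterModule D := fun j =>
    (CharacterModule.dual (LinearMap.smulRightₗ (LinearMap.proj j : (Fin n → R) →ₗ[R] R))) χ
  refine ⟨∑ j, (Pi.single j (1 : R) : Fin n → R) ⊗ₜ[R] c j, ?_⟩
  ext h
  have h2 : ∀ (s : Finset (Fin n)) (f : Fin n → CharacterModule ((Fin n → R) →ₗ[R] D)) h,
      (∑ j ∈ s, f j) h = ∑ j ∈ s, f j h := by
    intro s f h
    exact AddMonoidHom.finsetSum_apply (f : Fin n → (((Fin n → R) →ₗ[R] D) →+ AddCircle (1 : ℚ))) s h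
  rw [map_sum, h2]
  have h3 : h = ∑ j, (LinearMap.proj j : (Fin n → R) →ₗ[R] R).smulRight (h (Pi.single j 1)) := by
    ext k
    simp [LinearMap.sum_apply, Pi.single_apply]
  conv_rhs => rw [h3, map_sum]
  rfl

lemma dual_exact {X Y Z : Type u} [AddCommGroup X] [Module R X] [AddCommGroup Y] [Module R Y]
    [AddCommGroup Z] [Module R Z] (p : X →ₗ[R] Y) (q : Y →ₗ[R] Z) (h : Function.Exact p q)
    (ψ : CharacterModule Y) (hψ : CharacterModule.dual p ψ = 0) :
    ∃ χ, CharacterModule.dual q χ = ψ := by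
  let q' := q.rangeRestrict
  have hq' : Function.Surjective q'.toAddMonoidHom := q.surjective_rangeRestrict
  let ψ' : LinearMap.range q →+ AddCircle (1 : ℚ) :=
    q'.toAddMonoidHom.liftOfSurjective hq' ⟨ψ, by
      intro y hy
      have hy' : q y = 0 := congrArg Subtype.val (show q' y = 0 from hy)
      obtain ⟨x, rfl⟩ := (h y).1 hy'
      exact DFunLike.congr_fun hψ x⟩
  obtain ⟨χ, hχ⟩ := CharacterModule.dual_surjective_of_injective
    (LinearMap.range q).subtype Subtype.val_injective ψ'
  refine ⟨χ, ?_⟩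
  ext y
  have h1 : χ (q y) = ψ' (q' y) := DFunLike.congr_fun hχ (q' y)
  rw [CharacterModule.dual_apply]
  refine h1.trans ?_
  exact AddMonoidHom.liftOfRightInverse_comp_apply q'.toAddMonoidHom _
    (Function.rightInverse_surjInv hq') _ y

lemma lcomp_inj {A B : Type u} [AddCommGroup A] [Module R A] [AddCommGroup B] [Module R B]
    (p : A →ₗ[R] B) (hp : Function.Surjective p) : Function.Injective (LinearMap.lcomp R D p) := by
  intro a b hab
  ext x
  obtain ⟨y, rfl⟩ := hp x
  exact LinearMap.congr_fun hab y

lemma theta_surj (A : Type u) [AddCommGroup A] [Module R A] [Module.Finite R A] :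
    Function.Surjective (theta (R := R) D A) := by
  obtain ⟨n, p, hp⟩ := Module.Finite.exists_fin' R A
  intro χ
  obtain ⟨χ', rfl⟩ := CharacterModule.dual_surjective_of_injective _ (lcomp_inj D p hp) χ
  obtain ⟨z, rfl⟩ := theta_fin_surj D n χ'
  exact ⟨p.rTensor _ z, theta_nat D p z⟩

lemma theta_inj [IsNoetherianRing R] (A : Type u) [AddCommGroup A] [Module R A]
    [Module.Finite R A] : Function.Injective (theta (R := R) D A) := by
  obtain ⟨n, p, hp⟩ := Module.Finite.exists_fin' R A
  rw [injective_iff_map_eq_zero]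
  intro t ht
  obtain ⟨t, rfl⟩ := LinearMap.rTensor_surjective _ hp t
  rw [theta_nat] at ht
  have hex : Function.Exact (LinearMap.lcomp R D p) (LinearMap.lcomp R D (LinearMap.ker p).subtype) := by
    intro h
    constructor
    · intro hh
      have hk : LinearMap.ker p ≤ LinearMap.ker h := fun x hx => LinearMap.congr_fun hh ⟨x, hx⟩
      refine ⟨(Submodule.liftQ _ h hk) ∘ₗ (p.quotKerEquivOfSurjective hp).symm.toLinearMap, ?_⟩
      refine LinearMap.ext (fun x => ?_)
      have : (p.quotKerEquivOfSurjective hp).symm (p x) = Submodule.Quotient.mk x := by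
        rw [LinearEquiv.symm_apply_eq]; rfl
      simp [this]
    · rintro ⟨k, rfl⟩
      ext x
      simp
  obtain ⟨χ, hχ⟩ := dual_exact _ _ hex _ ht
  obtain ⟨k, rfl⟩ := theta_surj D _ χ
  rw [← theta_nat] at hχ
  rw [← theta_fin_inj D n hχ]
  exact (rTensor_exact _ (LinearMap.exact_subtype_ker_map p) hp).apply_apply_eq_zero k

end
end CD1

namespace CD1

section
variable {R : Type u} [CommRing R] (I : Ideal R)

/-- torsion-free injective quotient -/
lemma exists_tf [IsNoetherianRing R] : ∃ (E : Type u) (_ : AddCommGroup E) (_ : Module R E)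
    (_ : Module.Injective R E) (j : R →ₗ[R] E), Tors I (LinearMap.ker j) ∧ Gam I E = ⊥ := by
  obtain ⟨E, _, _, hE, f, hf⟩ := exists_inj (R := R) R
  have hG := Gam_injective I E
  refine ⟨E ⧸ Gam I E, inferInstance, inferInstance, ?_, (Gam I E).mkQ ∘ₗ f, ?_, ?_⟩
  · obtain ⟨r, hr⟩ := hG.out (Gam I E).subtype Subtype.val_injective LinearMap.id
    apply Module.Baer.injective
    intro J g
    let sec : (E ⧸ Gam I E) →ₗ[R] E := Submodule.liftQ _ (LinearMap.id - (Gam I E).subtype ∘ₗ r)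
      (fun x hx => by
        have := hr ⟨x, hx⟩
        simp at this
        simp [this])
    have hsec : ∀ y, (Gam I E).mkQ (sec y) = y := by
      intro y
      obtain ⟨y, rfl⟩ := Submodule.mkQ_surjective _ y
      simp [sec]
    obtain ⟨k, hk⟩ := Module.Baer.of_injective hE J (sec ∘ₗ g)
    refine ⟨(Gam I E).mkQ ∘ₗ k, fun x hx => ?_⟩
    rw [LinearMap.comp_apply, hk x hx, LinearMap.comp_apply, hsec]
  · rintro ⟨x, hx⟩
    have : f x ∈ Gam I E := by simpa using hx
    obtain ⟨n, hn⟩ := this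
    refine ⟨n, fun a ha => Subtype.ext (hf ?_)⟩
    have h3 := hn a ha
    rw [← map_smul] at h3
    exact h3.trans (map_zero f).symm
  · rw [eq_bot_iff]
    rintro y ⟨n, hn⟩
    obtain ⟨y, rfl⟩ := Submodule.mkQ_surjective _ y
    obtain ⟨s, hs⟩ := (isNoetherian_def.1 (inferInstance : IsNoetherian R R)) (I ^ n)
    have h1 : ∀ w ∈ (Submodule.map (LinearMap.toSpanSingleton R E y) (I ^ n)),
        ∃ n, ∀ a ∈ I ^ n, a • w = 0 := by
      rintro w ⟨a, ha, rfl⟩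
      have := hn a ha
      rw [← map_smul, Submodule.mkQ_apply, Submodule.Quotient.mk_eq_zero] at this
      exact this
    obtain ⟨m, hm⟩ := fg_killed I _ (Submodule.FG.map _ ⟨s, hs⟩) h1
    rw [Submodule.mem_bot, Submodule.mkQ_apply, Submodule.Quotient.mk_eq_zero]
    refine ⟨m + n, fun a ha => ?_⟩
    rw [pow_add] at ha
    refine Submodule.mul_induction_on ha (fun b hb c hc => ?_) (fun b c hb hc => ?_)
    · rw [mul_smul]
      exact hm _ ⟨c, hc, rfl⟩ b hb
    · rw [add_smul, hb, hc, add_zero]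

lemma exists_D [IsNoetherianRing R] : ∃ (D : Type u) (_ : AddCommGroup D) (_ : Module R D)
    (j : R →ₗ[R] D), Tors I (LinearMap.ker j) ∧ Tors I (D ⧸ LinearMap.range j) ∧
      (∀ d : D, (∀ a ∈ I, a • d = 0) → d = 0) ∧
      (∀ h : I →ₗ[R] D, ∃ d : D, ∀ a, h a = (a : R) • d) := by
  obtain ⟨E, _, _, hE, j, hj, hG⟩ := exists_tf I
  let D : Submodule R E := Submodule.comap (LinearMap.range j).mkQ (Gam I (E ⧸ LinearMap.range j))
  have hD : ∀ x, x ∈ D ↔ ∃ n, ∀ a ∈ I ^ n, a • x ∈ LinearMap.range j := by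
    intro x
    change (∃ n, ∀ a ∈ I ^ n, a • _ = _) ↔ _
    simp only [← map_smul]
    simp only [Submodule.mkQ_apply, Submodule.Quotient.mk_eq_zero]
  let j' : R →ₗ[R] D := j.codRestrict D (fun x => (hD _).2 ⟨0, fun a _ => ⟨a * x, by
    rw [← smul_eq_mul, map_smul]⟩⟩)
  have hr : ∀ x : D, x ∈ LinearMap.range j' ↔ (x : E) ∈ LinearMap.range j := by
    intro x
    constructor
    · rintro ⟨y, rfl⟩; exact ⟨y, rfl⟩
    · rintro ⟨y, hy⟩; exact ⟨y, Subtype.ext hy⟩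
  refine ⟨D, inferInstance, inferInstance, j', ?_, ?_, ?_, ?_⟩
  · rw [LinearMap.ker_codRestrict]; exact hj
  · intro w
    obtain ⟨w, rfl⟩ := Submodule.mkQ_surjective _ w
    obtain ⟨n, hn⟩ := (hD _).1 w.2
    refine ⟨n, fun a ha => ?_⟩
    rw [← map_smul, Submodule.mkQ_apply, Submodule.Quotient.mk_eq_zero, hr]
    exact hn a ha
  · intro d hd
    have : (d : E) ∈ Gam I E := ⟨1, fun a ha => by
      rw [pow_one] at ha
      exact congrArg Subtype.val (hd a ha)⟩
    rw [hG] at this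
    exact Subtype.ext this
  · intro h
    obtain ⟨k, hk⟩ := Module.Baer.of_injective hE I (D.subtype ∘ₗ h)
    have hk' : ∀ a ∈ I, a • k 1 ∈ D := by
      intro a ha
      rw [← map_smul, smul_eq_mul, mul_one, hk a ha]
      exact (h ⟨a, ha⟩).2
    have h1 : ∀ w ∈ (Submodule.map (LinearMap.toSpanSingleton R (E ⧸ LinearMap.range j)
        (Submodule.Quotient.mk (k 1))) I), ∃ n, ∀ a ∈ I ^ n, a • w = 0 := by
      rintro w ⟨a, ha, rfl⟩
      exact hk' a ha
    obtain ⟨m, hm⟩ := fg_killed I _ (Submodule.FG.map _ (IsNoetherian.noetherian I)) h1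
    have hkD : k 1 ∈ D := by
      refine ⟨m + 1, fun a ha => ?_⟩
      rw [pow_succ] at ha
      refine Submodule.mul_induction_on ha (fun b hb c hc => ?_) (fun b c hb hc => ?_)
      · rw [mul_smul]
        exact hm _ ⟨c, hc, rfl⟩ b hb
      · rw [add_smul, hb, hc, add_zero]
    refine ⟨⟨k 1, hkD⟩, fun a => Subtype.ext ?_⟩
    have := hk a a.2
    change ((h a : D) : E) = (a : R) • k 1
    rw [← map_smul, smul_eq_mul, mul_one, this]
    rfl

end
end CD1

namespace CD1

open CategoryTheory CategoryTheory.Abelian TensorProduct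

section
variable {R : Type u} [CommRing R] (D : Type u) [AddCommGroup D] [Module R D]

def X (i : ℕ) (W : ModuleCat.{u} R) : Prop :=
  ∀ α : Abelian.Ext W (ModuleCat.of R D) i, α = 0

section
variable (S : ShortComplex (ModuleCat.{u} R)) (hS : S.ShortExact)
include hS

lemma X_mid' (i : ℕ) (hA : X D i S.X₁) (hC : X D i S.X₃) : X D i S.X₂ := by
  intro α
  obtain ⟨β, rfl⟩ := Ext.contravariant_sequence_exact₂ (hS := hS) (Y := ModuleCat.of R D) α (hA _)
  rw [hC β, Ext.comp_zero]

lemma X_right' (i : ℕ) (hA : X D i S.X₁) (hB : X D (i+1) S.X₂) : X D (i+1) S.X₃ := by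
  intro α
  obtain ⟨β, rfl⟩ := Ext.contravariant_sequence_exact₃ (hS := hS) (Y := ModuleCat.of R D) (x₃ := α) (n₀ := i) (hB _)
    (by omega)
  rw [hA β, Ext.comp_zero]

lemma X_right_zero' (hA : ∀ h : S.X₁ ⟶ ModuleCat.of R D, ∃ h', S.f ≫ h' = h)
    (hB : X D 1 S.X₂) : X D 1 S.X₃ := by
  intro α
  obtain ⟨β, rfl⟩ := Ext.contravariant_sequence_exact₃ (hS := hS) (Y := ModuleCat.of R D) (x₃ := α) (n₀ := 0) (hB _)
    (by omega)
  obtain ⟨h, rfl⟩ := (Ext.mk₀_bijective _ _).2 β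
  obtain ⟨h', rfl⟩ := hA h
  rw [← Ext.mk₀_comp_mk₀, ← Ext.comp_assoc_of_second_deg_zero, hS.extClass_comp, Ext.zero_comp]
end

section
variable {A B C : Type u} [AddCommGroup A] [AddCommGroup B]
    [AddCommGroup C] [Module R A] [Module R B] [Module R C] (f : A →ₗ[R] B) (g : B →ₗ[R] C)
    (hf : Function.Injective f) (hg : Function.Surjective g) (h : Function.Exact f g)
include hf hg h

lemma X_mid (i : ℕ) (hA : X D i (ModuleCat.of R A)) (hC : X D i (ModuleCat.of R C)) :
    X D i (ModuleCat.of R B) := X_mid' D _ (ses f g hf hg h) i hA hC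

lemma X_right (i : ℕ) (hA : X D i (ModuleCat.of R A)) (hB : X D (i+1) (ModuleCat.of R B)) :
    X D (i+1) (ModuleCat.of R C) := X_right' D _ (ses f g hf hg h) i hA hB

lemma X_right_zero (hA : Function.Surjective (LinearMap.lcomp R D f))
    (hB : X D 1 (ModuleCat.of R B)) : X D 1 (ModuleCat.of R C) :=
  X_right_zero' D _ (ses f g hf hg h) (fun k => by
    obtain ⟨k', hk'⟩ := hA k.hom
    refine ⟨ModuleCat.ofHom k', ModuleCat.hom_ext hk'⟩) hB
end

lemma X_fin (n i : ℕ) : X D (i+1) (ModuleCat.of R (Fin n → R)) := by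
  have : Projective (ModuleCat.of R (Fin n → R)) := (IsProjective.iff_projective (Fin n → R)).1 inferInstance
  intro α
  exact Ext.eq_zero_of_projective α

lemma X_of_tor [IsNoetherianRing R] (i : ℕ) (A : Type u) [AddCommGroup A] [Module R A]
    [Module.Finite R A]
    (h : Subsingleton (TorMod R (i+1) (ModuleCat.of R A) (ModuleCat.of R (CharacterModule D)))) :
    X D (i+1) (ModuleCat.of R A) := by
  induction i generalizing A with
  | zero =>
    obtain ⟨n, p, hp⟩ := Module.Finite.exists_fin' R A
    have h1 := T1 (LinearMap.ker p).subtype p Subtype.val_injective hp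
      (LinearMap.exact_subtype_ker_map p) h
    refine X_right_zero D (LinearMap.ker p).subtype p Subtype.val_injective hp
      (LinearMap.exact_subtype_ker_map p) ?_ (X_fin D n 0)
    apply CharacterModule.surjective_of_dual_injective
    rw [injective_iff_map_eq_zero]
    intro χ hχ
    obtain ⟨z, rfl⟩ := theta_surj D _ χ
    rw [← theta_nat] at hχ
    have h2 := (injective_iff_map_eq_zero _).1 (theta_fin_inj D n) _ hχ
    have h3 := (injective_iff_map_eq_zero _).1 h1 _ h2
    rw [h3, map_zero]
  | succ i ih =>
    obtain ⟨n, p, hp⟩ := Module.Finite.exists_fin' R A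
    have h1 := T2 (LinearMap.ker p).subtype p Subtype.val_injective hp
      (LinearMap.exact_subtype_ker_map p) i h
    exact X_right D (LinearMap.ker p).subtype p Subtype.val_injective hp
      (LinearMap.exact_subtype_ker_map p) (i+1) (ih _ h1) (X_fin D n _)

lemma X_triv (i : ℕ) (W : Type u) [AddCommGroup W] [Module R W] [Subsingleton W] :
    X D i (ModuleCat.of R W) := by
  intro α
  have h : 𝟙 (ModuleCat.of R W) = 0 := by
    apply ModuleCat.hom_ext
    apply LinearMap.ext
    intro x
    exact Subsingleton.elim (α := W) _ _
  rw [← Ext.mk₀_id_comp α, h, Ext.mk₀_zero, Ext.zero_comp]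

lemma X_pow (i : ℕ) (B : Type u) [AddCommGroup B] [Module R B] (h : X D i (ModuleCat.of R B))
    (n : ℕ) : X D i (ModuleCat.of R (Fin n → B)) := by
  induction n with
  | zero => exact X_triv D i _
  | succ n ih =>
    refine X_mid D (LinearMap.single R (fun _ : Fin (n+1) => B) 0)
      (LinearMap.funLeft R B (Fin.succ : Fin n → Fin (n+1))) ?_ ?_ ?_ _ h ih
    · exact Pi.single_injective (M := fun _ : Fin (n+1) => B) 0
    · intro x
      exact ⟨Fin.cons 0 x, by ext j; simp [LinearMap.funLeft_apply]⟩
    · intro x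
      constructor
      · intro hx
        refine ⟨x 0, ?_⟩
        ext j
        refine Fin.cases ?_ (fun j => ?_) j
        · simp
        · have := congrFun hx j
          simp [LinearMap.funLeft_apply] at this ⊢
          exact this.symm
      · rintro ⟨y, rfl⟩
        ext j
        simp [LinearMap.funLeft_apply]

variable (I : Ideal R)

lemma X_killed [IsNoetherianRing R] (h0 : ∀ d : D, (∀ a ∈ I, a • d = 0) → d = 0)
    (h : ∀ i, X D (i+1) (ModuleCat.of R (R ⧸ I))) (i : ℕ) (A : Type u) [AddCommGroup A] [Module R A]
    [Module.Finite R A] (hA : ∀ a ∈ I, ∀ x : A, a • x = 0) : X D i (ModuleCat.of R A) := by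
  induction i generalizing A with
  | zero =>
    intro α
    obtain ⟨k, rfl⟩ := (Ext.mk₀_bijective _ _).2 α
    have : k = 0 := by
      apply ModuleCat.hom_ext
      apply LinearMap.ext
      intro x
      refine h0 _ (fun a ha => ?_)
      rw [← map_smul]
      exact (congrArg k.hom (hA a ha x)).trans (map_zero _)
    rw [this, Ext.mk₀_zero]
  | succ i ih =>
    obtain ⟨n, p, hp⟩ := Module.Finite.exists_fin' R A
    let q : (Fin n → R ⧸ I) →ₗ[R] A := ∑ j, (Submodule.liftQ I (LinearMap.toSpanSingleton R A
      (p (Pi.single j 1))) (fun a ha => hA a ha _)) ∘ₗ LinearMap.proj j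
    have hq : Function.Surjective q := by
      intro x
      obtain ⟨c, rfl⟩ := hp x
      refine ⟨fun j => Submodule.Quotient.mk (c j), ?_⟩
      conv_rhs => rw [LinearMap.pi_apply_eq_sum_univ p c]
      simp only [q, LinearMap.sum_apply]
      refine Finset.sum_congr rfl (fun j _ => ?_)
      change c j • p (Pi.single j 1) = _
      congr 2
      ext k
      simp [Pi.single_apply, eq_comm]
    refine X_right D (LinearMap.ker q).subtype q Subtype.val_injective hq
      (LinearMap.exact_subtype_ker_map q) i (ih _ ?_) (X_pow D _ _ (h i) n)
    rintro a ha ⟨x, hx⟩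
    apply Subtype.ext
    ext j
    change a • x j = 0
    obtain ⟨r, hr⟩ := Submodule.Quotient.mk_surjective _ (x j)
    rw [← hr, ← Submodule.Quotient.mk_smul, Submodule.Quotient.mk_eq_zero, smul_eq_mul]
    exact I.mul_mem_right _ ha

lemma X_Qt [IsNoetherianRing R] (h0 : ∀ d : D, (∀ a ∈ I, a • d = 0) → d = 0)
    (h : ∀ i, X D (i+1) (ModuleCat.of R (R ⧸ I))) (i n : ℕ) : X D i (Qt I n) := by
  induction n with
  | zero =>
    have : Subsingleton (R ⧸ I ^ 0) := by
      rw [pow_zero, Ideal.one_eq_top]; infer_instance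
    exact X_triv D i _
  | succ n ih =>
    let q : (R ⧸ I ^ (n+1)) →ₗ[R] (R ⧸ I ^ n) := (tr I (Nat.le_succ n)).hom
    have hq : Function.Surjective q := by
      intro x
      obtain ⟨r, rfl⟩ := Submodule.Quotient.mk_surjective _ x
      exact ⟨Submodule.Quotient.mk r, rfl⟩
    refine X_mid D (LinearMap.ker q).subtype q Subtype.val_injective hq
      (LinearMap.exact_subtype_ker_map q) i (X_killed D I h0 h i _ ?_) ih
    rintro a ha ⟨x, hx⟩
    apply Subtype.ext
    obtain ⟨r, rfl⟩ := Submodule.Quotient.mk_surjective _ x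
    have hr : r ∈ I ^ n := by
      have hx' : (Submodule.Quotient.mk r : R ⧸ I ^ n) = 0 := hx
      exact (Submodule.Quotient.mk_eq_zero _).1 hx'
    change a • (Submodule.Quotient.mk r : R ⧸ I ^ (n+1)) = 0
    rw [← Submodule.Quotient.mk_smul, Submodule.Quotient.mk_eq_zero, smul_eq_mul, pow_succ, mul_comm a r]
    exact Ideal.mul_mem_mul hr ha

lemma bwd [IsNoetherianRing R] (H : ∀ M : ModuleCat.{u} R,
        (Subsingleton (TorMod R 0 (ModuleCat.of R (R ⧸ I)) M) ∧
          Subsingleton (TorMod R 1 (ModuleCat.of R (R ⧸ I)) M)) →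
        ∀ i : ℕ, Subsingleton (TorMod R i (ModuleCat.of R (R ⧸ I)) M)) (i : ℕ) :
    V I (i+2) (ModuleCat.of R R) := by
  obtain ⟨D, _, _, j, hj1, hj2, h0, h1⟩ := exists_D I
  have hT := H (ModuleCat.of R (CharacterModule D)) (by
    constructor
    · rw [tor_zero]
      have : Subsingleton ((R ⧸ I) →ₗ[R] D) := by
        refine subsingleton_of_forall_eq 0 (fun k => ?_)
        refine LinearMap.ext (fun x => ?_)
        refine h0 _ (fun a ha => ?_)
        obtain ⟨r, rfl⟩ := Submodule.Quotient.mk_surjective _ x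
        rw [← map_smul, ← Submodule.Quotient.mk_smul, (Submodule.Quotient.mk_eq_zero I).2, map_zero]
        exact I.mul_mem_right _ ha
      have : Subsingleton (CharacterModule ((R ⧸ I) →ₗ[R] D)) := by
        refine subsingleton_of_forall_eq 0 (fun k => ?_)
        ext x
        rw [Subsingleton.elim x 0, map_zero, map_zero]
      exact (theta_inj D (R ⧸ I)).subsingleton
    · refine T3 I.subtype I.mkQ Subtype.val_injective (Submodule.mkQ_surjective _)
        (LinearMap.exact_subtype_mkQ _) ?_
      rw [injective_iff_map_eq_zero]
      intro z hz
      have hs : Function.Surjective (LinearMap.lcomp R D I.subtype) := by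
        intro k
        obtain ⟨d, hd⟩ := h1 k
        exact ⟨LinearMap.toSpanSingleton R D d, LinearMap.ext (fun a => (hd a).symm)⟩
      have h2 : theta D R (I.subtype.rTensor _ z) = 0 := (congrArg _ hz).trans (map_zero _)
      rw [theta_nat] at h2
      have h3 := (injective_iff_map_eq_zero _).1
        (CharacterModule.dual_injective_of_surjective _ hs) _ h2
      exact (injective_iff_map_eq_zero _).1 (theta_inj D I) _ h3)
  have hV : ∀ k, V I k (ModuleCat.of R D) := fun k n α => ⟨n, le_rfl, by
    rw [X_Qt D I h0 (fun i => X_of_tor D i _ (hT _)) k n α, Ext.comp_zero]⟩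
  have hr : V I (i+1+1) (ModuleCat.of R (LinearMap.range j)) :=
    V_left I (LinearMap.range j).subtype (LinearMap.range j).mkQ Subtype.val_injective
      (Submodule.mkQ_surjective _) (LinearMap.exact_subtype_mkQ _) (i+1) (V_tors I i _ hj2) (hV _)
  refine V_mid I (LinearMap.ker j).subtype j.rangeRestrict Subtype.val_injective
    j.surjective_rangeRestrict ?_ (i+1+1) (V_tors I _ _ hj1) hr
  intro x
  simp [Subtype.ext_iff]

end

end CD1

theorem stmt11 (R : Type u) [CommRing R] [IsNoetherianRing R] (I : Ideal R) :
    (∀ i : ℕ, 2 ≤ i → Subsingleton (LC R I i (ModuleCat.of R R))) ↔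
      ∀ M : ModuleCat.{u} R,
        (Subsingleton (TorMod R 0 (ModuleCat.of R (R ⧸ I)) M) ∧
          Subsingleton (TorMod R 1 (ModuleCat.of R (R ⧸ I)) M)) →
        ∀ i : ℕ, Subsingleton (TorMod R i (ModuleCat.of R (R ⧸ I)) M) := by
  constructor
  · intro h M hM i
    refine CD1.fwd I (fun k hk => ?_) M hM.1 hM.2 i
    obtain ⟨l, rfl⟩ : ∃ l, k = l + 1 := ⟨k - 1, by omega⟩
    exact (CD1.bridge I l _).1 (h _ hk)
  · intro H i hi
    obtain ⟨l, rfl⟩ : ∃ l, i = l + 1 + 1 := ⟨i - 2, by omega⟩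
    exact (CD1.bridge I (l+1) _).2 (CD1.bwd I H l)
end
end

section
/- Let R be a commutative Noetherian ring and I an ideal of R. Then cd(I, R) ≤ 1 if and only if for every R-module M, the vanishing Hom_R(R/I, M) = Ext_R^1(R/I, M) = 0 implies Ext_R^i(R/I, M) = 0 for all i ≥ 0. -/
open CategoryTheory

noncomputable section

universe u

namespace S12
open Limits Opposite
variable {R : Type u} [CommRing R]

abbrev YF (Y : ModuleCat.{u} R) : ModuleCat.{u} R ⥤ (ModuleCat.{u} R)ᵒᵖ :=
  ((linearYoneda R (ModuleCat.{u} R)).obj Y).rightOp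

abbrev KK {X : ModuleCat.{u} R} (P : ProjectiveResolution X) (Y : ModuleCat.{u} R) :
    ChainComplex (ModuleCat.{u} R)ᵒᵖ ℕ := ((YF Y).mapHomologicalComplex _).obj P.complex

def theHom {X : ModuleCat.{u} R} (P : ProjectiveResolution X) (n : ℕ) (Y : ModuleCat.{u} R) :
    ((KK P Y).homology n).unop ⟶ ExtMod R n X Y :=
  (P.isoLeftDerivedObj (YF Y) n).hom.unop

instance {X : ModuleCat.{u} R} (P : ProjectiveResolution X) (n : ℕ) (Y : ModuleCat.{u} R) :
    IsIso (theHom P n Y) := (P.isoLeftDerivedObj (YF Y) n).unop.isIso_hom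

def Rel {X : ModuleCat.{u} R} (P : ProjectiveResolution X) (n : ℕ) (Y : ModuleCat.{u} R)
    (f : P.complex.X n ⟶ Y) (e : ExtMod R n X Y) : Prop :=
  ∃ z : ((KK P Y).opcycles n).unop, (((KK P Y).pOpcycles n).unop).hom z = f ∧
    (theHom P n Y).hom ((((KK P Y).homologyι n).unop).hom z) = e

variable {X : ModuleCat.{u} R} (P : ProjectiveResolution X) (n : ℕ) (Y : ModuleCat.{u} R)

lemma theHom_bij : Function.Bijective (theHom P n Y).hom :=
  (ConcreteCategory.bijective_of_isIso (theHom P n Y))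

lemma p_inj : Function.Injective (((KK P Y).pOpcycles n).unop).hom := by
  have : Mono (((KK P Y).pOpcycles n).unop) := inferInstance
  exact (ModuleCat.mono_iff_injective _).1 this

lemma i_surj : Function.Surjective (((KK P Y).homologyι n).unop).hom := by
  have : Epi (((KK P Y).homologyι n).unop) := inferInstance
  exact (ModuleCat.epi_iff_surjective _).1 this

lemma p_exact (f : P.complex.X n ⟶ Y) :
    (∃ z : ((KK P Y).opcycles n).unop, (((KK P Y).pOpcycles n).unop).hom z = f) ↔
      P.complex.d (n+1) n ≫ f = 0 := by
  have h := (ShortComplex.exact_of_g_is_cokernel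
    (ShortComplex.mk _ _ ((KK P Y).d_pOpcycles (n+1) n))
    ((KK P Y).opcyclesIsCokernel (n+1) n (by simp))).unop
  have h2 := (ShortComplex.ShortExact.moduleCat_exact_iff_function_exact _).1 h
  exact (h2 f).symm

lemma i_exact (p : ℕ) (hp : p + 1 = n) (z : ((KK P Y).opcycles n).unop) :
    (((KK P Y).homologyι n).unop).hom z = 0 ↔
      ∃ g : P.complex.X p ⟶ Y, P.complex.d n p ≫ g = (((KK P Y).pOpcycles n).unop).hom z := by
  have h := (ShortComplex.exact_of_f_is_kernel
    (ShortComplex.mk _ _ ((KK P Y).homologyι_comp_fromOpcycles n p))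
    ((KK P Y).homologyIsKernel n p (by subst hp; simp))).unop
  have h2 := (ShortComplex.ShortExact.moduleCat_exact_iff_function_exact _).1 h
  refine (h2 z).trans ?_
  have h3 : ((KK P Y).fromOpcycles n p).unop ≫ ((KK P Y).pOpcycles n).unop = ((KK P Y).d n p).unop := by
    rw [← unop_comp, HomologicalComplex.p_fromOpcycles]
  constructor
  · rintro ⟨g, hg⟩
    refine ⟨g, ?_⟩
    rw [← hg]
    exact (congrArg (fun q => q.hom g) h3).symm
  · rintro ⟨g, hg⟩
    refine ⟨g, p_inj P n Y ?_⟩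
    rw [← hg]
    exact (congrArg (fun q => q.hom g) h3)

lemma i_exact0 (z : ((KK P Y).opcycles 0).unop) 
    (hz : (((KK P Y).homologyι 0).unop).hom z = 0) : z = 0 := by
  have h := (ShortComplex.exact_of_f_is_kernel
    (ShortComplex.mk _ _ ((KK P Y).homologyι_comp_fromOpcycles 0 0))
    ((KK P Y).homologyIsKernel 0 0 (by simp))).unop
  have h2 := (ShortComplex.ShortExact.moduleCat_exact_iff_function_exact _).1 h
  obtain ⟨g, hg⟩ := (h2 z).1 hz
  have h3 : ((KK P Y).fromOpcycles 0 0) = 0 := by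
    rw [← cancel_epi ((KK P Y).pOpcycles 0), HomologicalComplex.p_fromOpcycles]
    rw [comp_zero]
    exact (KK P Y).shape _ _ (by simp)
  rw [← hg]
  change (((KK P Y).fromOpcycles 0 0).unop).hom g = 0
  rw [h3]; rfl

variable {P n Y}

lemma Rel.cocycle {f e} (h : Rel P n Y f e) : P.complex.d (n+1) n ≫ f = 0 :=
  (p_exact P n Y f).1 ⟨h.choose, h.choose_spec.1⟩

lemma rel_surj (e : ExtMod R n X Y) : ∃ f, Rel P n Y f e := by
  obtain ⟨w, rfl⟩ := (theHom_bij P n Y).2 e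
  obtain ⟨z, rfl⟩ := i_surj P n Y w
  exact ⟨_, z, rfl, rfl⟩

lemma rel_exists {f : P.complex.X n ⟶ Y} (h : P.complex.d (n+1) n ≫ f = 0) :
    ∃ e, Rel P n Y f e := by
  obtain ⟨z, hz⟩ := (p_exact P n Y f).2 h
  exact ⟨_, z, hz, rfl⟩

lemma Rel.eq_zero_iff {f e} (h : Rel P n Y f e) (p : ℕ) (hp : p + 1 = n) :
    e = 0 ↔ ∃ g : P.complex.X p ⟶ Y, P.complex.d n p ≫ g = f := by
  obtain ⟨z, rfl, rfl⟩ := h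
  rw [← i_exact P n Y p hp z]
  exact map_eq_zero_iff (theHom P n Y).hom (theHom_bij P n Y).1

lemma Rel.eq_zero_iff0 {f e} (h : Rel P 0 Y f e) : e = 0 ↔ f = 0 := by
  obtain ⟨z, rfl, rfl⟩ := h
  rw [map_eq_zero_iff (theHom P 0 Y).hom (theHom_bij P 0 Y).1]
  constructor
  · intro hz
    rw [i_exact0 P Y z hz]; exact map_zero _
  · intro hz
    have := p_inj P 0 Y (hz.trans (map_zero _).symm)
    rw [this]; exact map_zero _

lemma Rel.map {X' : ModuleCat.{u} R} {P' : ProjectiveResolution X'} {f e} (h : Rel P n Y f e)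
    (g : X' ⟶ X) (φ : ProjectiveResolution.Hom P' P g) :
    Rel P' n Y (φ.hom.f n ≫ f) ((((Ext R (ModuleCat.{u} R) n).map g.op).app Y).hom e) := by
  obtain ⟨z, rfl, rfl⟩ := h
  let ψ := ((YF Y).mapHomologicalComplex (ComplexShape.down ℕ)).map φ.hom
  refine ⟨((HomologicalComplex.opcyclesMap ψ n).unop).hom z, ?_, ?_⟩
  · have h1 := congrArg Quiver.Hom.unop (HomologicalComplex.p_opcyclesMap ψ n)
    exact congrArg (fun q => q.hom z) h1
  · have h1 := congrArg Quiver.Hom.unop (HomologicalComplex.homologyι_naturality ψ n)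
    have h2 := congrArg Quiver.Hom.unop (ProjectiveResolution.isoLeftDerivedObj_hom_naturality g P' P
      φ.hom φ.hom_f_zero_comp_π_f_zero (YF Y) n)
    have h1' := congrArg (fun q => q.hom z) h1
    have h2' := congrArg (fun q => q.hom ((((KK P Y).homologyι n).unop).hom z)) h2
    refine Eq.trans ?_ h2'.symm
    exact congrArg (theHom P' n Y).hom h1'.symm

def liftHom {X' : ModuleCat.{u} R} (P' : ProjectiveResolution X') (P : ProjectiveResolution X)
    (g : X' ⟶ X) : ProjectiveResolution.Hom P' P g where
  hom := ProjectiveResolution.lift g P' P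
  hom_f_zero_comp_π_f_zero := ProjectiveResolution.lift_commutes_zero g P' P

/-- bridge for elements -/
lemma ext_iff_zero (n : ℕ) (hn : 1 ≤ n) (f : P.complex.X n ⟶ Y) (e : ExtMod R n X Y)
    (h : Rel P n Y f e) : P.extMk f (n+1) rfl h.cocycle = 0 ↔ e = 0 := by
  obtain ⟨p, rfl⟩ : ∃ p, n = p + 1 := ⟨n - 1, by omega⟩
  rw [P.extMk_eq_zero_iff _ _ _ _ p rfl, h.eq_zero_iff p rfl]

lemma subsingleton_iff (n : ℕ) (X Y : ModuleCat.{u} R) :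
    Subsingleton (ExtMod R n X Y) ↔ Subsingleton (Abelian.Ext.{u} X Y n) := by
  let P := projectiveResolution X
  rcases Nat.eq_zero_or_pos n with rfl | hn
  · rw [Abelian.Ext.addEquiv₀.toEquiv.subsingleton_congr]
    constructor
    · intro h
      refine ⟨fun a b => ?_⟩
      suffices ∀ a : X ⟶ Y, a = 0 by rw [this a, this b]
      intro a
      obtain ⟨e, he⟩ := rel_exists (P := P) (n := 0) (f := P.π.f 0 ≫ a)
        ((Category.assoc _ _ _).symm.trans ((congrArg (· ≫ a) P.complex_d_comp_π_f_zero).trans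
          zero_comp))
      have h0 := he.eq_zero_iff0.1 (Subsingleton.elim _ _)
      have := (cancel_epi (P.π.f 0) (g := a) (h := 0)).1 (by rw [h0]; exact comp_zero.symm)
      exact this
    · intro h
      refine ⟨fun a b => ?_⟩
      suffices ∀ a : ExtMod R 0 X Y, a = 0 by rw [this a, this b]
      intro a
      obtain ⟨f, hf⟩ := rel_surj (P := P) a
      rw [hf.eq_zero_iff0]
      have h1 := P.exact₀.g_desc f hf.cocycle
      have h2 : P.exact₀.desc f hf.cocycle = 0 := h.elim _ _
      rw [h2, comp_zero] at h1
      exact h1.symm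
  · constructor
    · intro h
      refine ⟨fun a b => ?_⟩
      suffices ∀ a : Abelian.Ext.{u} X Y n, a = 0 by rw [this a, this b]
      intro a
      obtain ⟨f, hf, rfl⟩ := P.extMk_surjective a (n+1) rfl
      obtain ⟨e, he⟩ := rel_exists hf
      exact (ext_iff_zero n hn f e he).2 (Subsingleton.elim _ _)
    · intro h
      refine ⟨fun a b => ?_⟩
      suffices ∀ a : ExtMod R n X Y, a = 0 by rw [this a, this b]
      intro a
      obtain ⟨f, hf⟩ := rel_surj (P := P) a
      exact (ext_iff_zero n hn f a hf).1 (Subsingleton.elim _ _)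


abbrev Q (I : Ideal R) (n : ℕ) : ModuleCat.{u} R := ModuleCat.of R (R ⧸ I ^ n)

def q (I : Ideal R) {n m : ℕ} (h : n ≤ m) : Q I m ⟶ Q I n :=
  ModuleCat.ofHom <| Submodule.mapQ _ _ LinearMap.id (Ideal.pow_le_pow_right h)

/-- vanishing of local cohomology in degree `j`, elementwise -/
def V (I : Ideal R) (j : ℕ) (M : ModuleCat.{u} R) : Prop :=
  ∀ n, ∀ e : Abelian.Ext.{u} (Q I n) M j, ∃ m, ∃ h : n ≤ m,
    (Abelian.Ext.mk₀ (q I h)).comp e (zero_add j) = 0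

lemma LC_iff_aux (I : Ideal R) (j : ℕ) (M : ModuleCat.{u} R) :
    Subsingleton (LC R I j M) ↔ ∀ n, ∀ e : ExtMod R j (Q I n) M, ∃ m, ∃ h : n ≤ m,
      (((Ext R (ModuleCat.{u} R) j).map (q I h).op).app M).hom e = 0 := by
  let D := localCohomology.diagram (localCohomology.idealPowersDiagram I) j
  let D' := D ⋙ (evaluation _ _).obj M
  have hasc : HasColimit D := localCohomology.hasColimitDiagram.{u, 0} _ _
  let hc := isColimitOfPreserves ((evaluation (ModuleCat.{u} R) (ModuleCat.{u} R)).obj M)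
    (colimit.isColimit D)
  have hp0 : PreservesFilteredColimitsOfSize.{0, 0} (forget (ModuleCat.{u} R)) :=
    preservesFilteredColimitsOfSize_shrink.{0, u, 0, u} _
  have hp : PreservesColimit D' (forget (ModuleCat.{u} R)) := inferInstance
  constructor
  · intro hs n e
    have := (Concrete.isColimit_rep_eq_iff_exists D' (i := op (op n)) (j := op (op n)) hc
      (e : D'.obj (op (op n))) (0 : D'.obj (op (op n)))).1 (hs.elim _ _)
    obtain ⟨k, f, g, h⟩ := this
    refine ⟨k.unop.unop, f.unop.unop.le, ?_⟩
    exact h.trans (map_zero (D'.map g).hom)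
  · intro H
    refine ⟨fun a b => ?_⟩
    suffices ∀ a : LC R I j M, a = 0 by rw [this a, this b]
    intro a
    obtain ⟨k, e, he⟩ := Concrete.isColimit_exists_rep D' hc a
    obtain ⟨m, h, hm⟩ := H k.unop.unop e
    let w : k ⟶ op (op m) := (homOfLE h).op.op
    refine he.symm.trans ?_
    have h0 := congrArg (fun t => t.hom e)
      ((((evaluation (ModuleCat.{u} R) (ModuleCat.{u} R)).obj M).mapCocone (colimit.cocone D)).w w)
    refine h0.symm.trans ?_
    refine (congrArg _ hm).trans ?_
    exact map_zero ((((evaluation (ModuleCat.{u} R) (ModuleCat.{u} R)).obj M).mapCocone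
      (colimit.cocone D)).ι.app (op (op m))).hom

lemma LC_iff (I : Ideal R) (j : ℕ) (hj : 1 ≤ j) (M : ModuleCat.{u} R) :
    Subsingleton (LC R I j M) ↔ V I j M := by
  rw [LC_iff_aux]
  constructor
  · intro H n e
    let P := projectiveResolution (Q I n)
    obtain ⟨f, hf, rfl⟩ := P.extMk_surjective e (j+1) rfl
    obtain ⟨e, he⟩ := rel_exists hf
    obtain ⟨m, h, hm⟩ := H n e
    refine ⟨m, h, ?_⟩
    let φ := liftHom (projectiveResolution (Q I m)) P (q I h)
    rw [ProjectiveResolution.mk₀_comp_extMk f (j+1) rfl hf φ]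
    exact (ext_iff_zero j hj _ _ (he.map _ φ)).2 hm
  · intro H n e
    let P := projectiveResolution (Q I n)
    obtain ⟨f, hf⟩ := rel_surj (P := P) e
    obtain ⟨m, h, hm⟩ := H n (P.extMk f (j+1) rfl hf.cocycle)
    refine ⟨m, h, ?_⟩
    let φ := liftHom (projectiveResolution (Q I m)) P (q I h)
    rw [ProjectiveResolution.mk₀_comp_extMk f (j+1) rfl hf.cocycle φ] at hm
    exact (ext_iff_zero j hj _ _ (hf.map _ φ)).1 hm


def EZ (X Y : ModuleCat.{u} R) (i : ℕ) : Prop := ∀ e : Abelian.Ext.{u} X Y i, e = 0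

lemma EZ_iff (X Y : ModuleCat.{u} R) (i : ℕ) : EZ X Y i ↔ Subsingleton (ExtMod R i X Y) := by
  rw [subsingleton_iff]
  exact ⟨fun h => ⟨fun a b => by rw [h a, h b]⟩, fun h e => Subsingleton.elim _ _⟩

lemma EZ_zero_iff (X Y : Type u) [AddCommGroup X] [Module R X] [AddCommGroup Y] [Module R Y] :
    EZ (ModuleCat.of R X) (ModuleCat.of R Y) 0 ↔ ∀ f : X →ₗ[R] Y, f = 0 := by
  constructor
  · intro h f
    have := (Abelian.Ext.mk₀_eq_zero_iff (ModuleCat.ofHom f)).1 (h _)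
    exact congrArg ModuleCat.Hom.hom this
  · intro h e
    obtain ⟨f, rfl⟩ := (Abelian.Ext.mk₀_bijective _ _).2 e
    rw [Abelian.Ext.mk₀_eq_zero_iff]
    exact ModuleCat.hom_ext (h f.hom)

def sc {A B C : Type u} [AddCommGroup A] [Module R A] [AddCommGroup B] [Module R B]
    [AddCommGroup C] [Module R C] (f : A →ₗ[R] B) (g : B →ₗ[R] C) (h : Function.Exact f g) :
    ShortComplex (ModuleCat.{u} R) :=
  ShortComplex.mk (ModuleCat.ofHom f) (ModuleCat.ofHom g)
    (by rw [← ModuleCat.ofHom_comp, h.linearMap_comp_eq_zero]; rfl)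

lemma ses {A B C : Type u} [AddCommGroup A] [Module R A] [AddCommGroup B] [Module R B]
    [AddCommGroup C] [Module R C] (f : A →ₗ[R] B) (g : B →ₗ[R] C) (h : Function.Exact f g)
    (hf : Function.Injective f) (hg : Function.Surjective g) : (sc f g h).ShortExact :=
  ModuleCat.shortComplex_shortExact _ h hf hg

lemma ses_ker {B C : Type u} [AddCommGroup B] [Module R B]
    [AddCommGroup C] [Module R C] (g : B →ₗ[R] C) 
    (hg : Function.Surjective g) : (sc (LinearMap.ker g).subtype g
      (LinearMap.exact_subtype_ker_map g)).ShortExact :=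
  ses _ _ _ (Submodule.subtype_injective _) hg

lemma ses_mkQ {B : Type u} [AddCommGroup B] [Module R B] (N : Submodule R B) :
    (sc N.subtype N.mkQ (LinearMap.exact_subtype_mkQ N)).ShortExact :=
  ses _ _ _ (Submodule.subtype_injective _) (Submodule.mkQ_surjective _)

lemma epi_inj {S : ShortComplex (ModuleCat.{u} R)} (hS : S.ShortExact) (Y : ModuleCat.{u} R) (j : ℕ)
    (h : ∀ k, k + 1 = j → EZ S.X₁ Y k) (e : Abelian.Ext.{u} S.X₃ Y j)
    (he : (Abelian.Ext.mk₀ S.g).comp e (zero_add j) = 0) : e = 0 := by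
  cases j with
  | zero =>
    have := hS.epi_g
    exact Abelian.Ext.precomp_mk₀_injective_of_epi Y S.g (by simpa using he)
  | succ k =>
    obtain ⟨x, hx⟩ := Abelian.Ext.contravariant_sequence_exact₃ hS Y e he (n₀ := k) (by omega)
    rw [← hx, h k rfl x, Abelian.Ext.comp_zero]

lemma EZ_mid {S : ShortComplex (ModuleCat.{u} R)} (hS : S.ShortExact) (Y : ModuleCat.{u} R) (j : ℕ)
    (h1 : EZ S.X₁ Y j) (h3 : EZ S.X₃ Y j) : EZ S.X₂ Y j := by
  intro e
  obtain ⟨x, hx⟩ := Abelian.Ext.contravariant_sequence_exact₂ hS Y e (h1 _)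
  rw [← hx, h3 x, Abelian.Ext.comp_zero]

lemma EZ_tors [IsNoetherianRing R] (I : Ideal R) (Y : ModuleCat.{u} R) (j : ℕ)
    (h : ∀ k ≤ j, EZ (ModuleCat.of R (R ⧸ I)) Y k) :
    ∀ (N : Type u) [AddCommGroup N] [Module R N] [Module.Finite R N] (n : ℕ)
      (_ : ∀ r ∈ I ^ n, ∀ x : N, r • x = 0), EZ (ModuleCat.of R N) Y j := by
  induction j with
  | zero => ?_
  | succ j ih => ?_
  all_goals
    intro N _ _ _ n
    refine IsNoetherianRing.induction_on_isQuotientEquivQuotientPrime R (M := N) inferInstance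
      (motive := fun N _ _ _ => (∀ r ∈ I ^ n, ∀ x : N, r • x = 0) → EZ (ModuleCat.of R N) Y _)
      ?_ ?_ ?_
    · intro N _ _ _ _ _ e
      have : (𝟙 (ModuleCat.of R N)) = 0 := by
        ext x; exact Subsingleton.elim (α := N) _ _
      rw [← Abelian.Ext.mk₀_id_comp e, this, Abelian.Ext.mk₀_zero, Abelian.Ext.zero_comp]
    · intro N _ _ _ p e hN
      have hp : I ≤ p.asIdeal := by
        have : I ^ n ≤ p.asIdeal := by
          intro r hr
          have h1 := hN r hr (e.symm (Ideal.Quotient.mk _ 1))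
          rw [← map_smul, LinearEquiv.map_eq_zero_iff, Algebra.smul_def, map_one, mul_one] at h1
          exact Ideal.Quotient.eq_zero_iff_mem.1 h1
        exact p.isPrime.le_of_pow_le this
      let g : (R ⧸ I) →ₗ[R] N := e.symm.toLinearMap ∘ₗ (Ideal.Quotient.factorₐ R hp).toLinearMap
      have hg : Function.Surjective g :=
        e.symm.surjective.comp (Ideal.Quotient.factor_surjective hp)
      intro x
      refine epi_inj (ses_ker g hg) Y _ ?_ x (h _ le_rfl _)
      rintro k hk
      first
      | omega
      | obtain rfl : k = j := by omega
        refine ih (fun k hk => h k (by omega)) (LinearMap.ker g) 1 ?_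
        rintro r hr ⟨x, hx⟩
        rw [pow_one] at hr
        apply Subtype.ext
        obtain ⟨x, rfl⟩ := Ideal.Quotient.mk_surjective x
        change r • (Ideal.Quotient.mk I x) = 0
        rw [Algebra.smul_def]
        change Ideal.Quotient.mk I r * _ = 0
        rw [Ideal.Quotient.eq_zero_iff_mem.2 hr, zero_mul]
    · intro N1 _ _ _ N2 _ _ _ N3 _ _ _ f g hf hg hfg h1 h3 hN
      refine EZ_mid (ses f g hfg hf hg) Y _ (h1 ?_) (h3 ?_)
      · intro r hr x
        apply hf
        rw [map_smul, hN r hr, map_zero]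
      · intro r hr x
        obtain ⟨x, rfl⟩ := hg x
        rw [← map_smul, hN r hr, map_zero]

/-! V and short exact sequences -/
lemma q_comp (I : Ideal R) {a b c : ℕ} (h : a ≤ b) (h' : b ≤ c) :
    q I h' ≫ q I h = q I (h.trans h') := by
  ext; rfl

lemma V_mid {S : ShortComplex (ModuleCat.{u} R)} (hS : S.ShortExact) (I : Ideal R) (j : ℕ)
    (h1 : V I j S.X₁) (h3 : V I j S.X₃) : V I j S.X₂ := by
  intro n e
  obtain ⟨m, hm, h⟩ := h3 n (e.comp (Abelian.Ext.mk₀ S.g) (add_zero j))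
  obtain ⟨x, hx⟩ := Abelian.Ext.covariant_sequence_exact₂ (Q I m) hS
    ((Abelian.Ext.mk₀ (q I hm)).comp e (zero_add j))
    (by rw [← h, Abelian.Ext.comp_assoc _ _ _ _ _ (by omega)])
  obtain ⟨m', hm', h'⟩ := h1 m x
  refine ⟨m', hm.trans hm', ?_⟩
  rw [← q_comp I hm hm', ← Abelian.Ext.mk₀_comp_mk₀_assoc, ← hx,
    ← Abelian.Ext.comp_assoc _ _ _ (zero_add _) _ (by omega), h', Abelian.Ext.zero_comp]

lemma V_right {S : ShortComplex (ModuleCat.{u} R)} (hS : S.ShortExact) (I : Ideal R) (j : ℕ)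
    (h1 : V I (j+1) S.X₁) (h3 : V I j S.X₂) : V I j S.X₃ := by
  intro n e
  obtain ⟨m, hm, h⟩ := h1 n (e.comp hS.extClass rfl)
  obtain ⟨x, hx⟩ := Abelian.Ext.covariant_sequence_exact₃ (Q I m) hS
    ((Abelian.Ext.mk₀ (q I hm)).comp e (zero_add j)) rfl
    (by rw [← h, Abelian.Ext.comp_assoc _ _ _ _ _ (by omega)])
  obtain ⟨m', hm', h'⟩ := h3 m x
  refine ⟨m', hm.trans hm', ?_⟩
  rw [← q_comp I hm hm', ← Abelian.Ext.mk₀_comp_mk₀_assoc, ← hx,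
    ← Abelian.Ext.comp_assoc _ _ _ (zero_add _) _ (by omega), h', Abelian.Ext.zero_comp]

lemma V_left {S : ShortComplex (ModuleCat.{u} R)} (hS : S.ShortExact) (I : Ideal R) (j : ℕ)
    (h1 : V I (j+1) S.X₂) (h3 : V I j S.X₃) : V I (j+1) S.X₁ := by
  intro n e
  obtain ⟨m, hm, h⟩ := h1 n (e.comp (Abelian.Ext.mk₀ S.f) (add_zero _))
  obtain ⟨x, hx⟩ := Abelian.Ext.covariant_sequence_exact₁ (Q I m) hS
    ((Abelian.Ext.mk₀ (q I hm)).comp e (zero_add _)) 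
    (by rw [← h, Abelian.Ext.comp_assoc _ _ _ _ _ (by omega)]) rfl
  obtain ⟨m', hm', h'⟩ := h3 m x
  refine ⟨m', hm.trans hm', ?_⟩
  rw [← q_comp I hm hm', ← Abelian.Ext.mk₀_comp_mk₀_assoc, ← hx,
    ← Abelian.Ext.comp_assoc _ _ _ (zero_add _) _ (by omega), h', Abelian.Ext.zero_comp]

lemma V_inj (I : Ideal R) (j : ℕ) (J : ModuleCat.{u} R) [Injective J] : V I (j+1) J :=
  fun n e => ⟨n, le_rfl, by rw [Abelian.Ext.eq_zero_of_injective e, Abelian.Ext.comp_zero]⟩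

lemma q_surj (I : Ideal R) {a b : ℕ} (h : a ≤ b) : Function.Surjective (q I h).hom := by
  intro x
  obtain ⟨x, rfl⟩ := Ideal.Quotient.mk_surjective x
  exact ⟨Ideal.Quotient.mk _ x, rfl⟩

/-- If Ext^0, Ext^1 vanish and V in degrees ≥ 2 then all Ext vanish. -/
lemma EZ_of_V [IsNoetherianRing R] (I : Ideal R) (Y : ModuleCat.{u} R)
    (h0 : EZ (ModuleCat.of R (R ⧸ I)) Y 0) (h1 : EZ (ModuleCat.of R (R ⧸ I)) Y 1)
    (hV : ∀ j ≥ 2, V I j Y) (j : ℕ) : EZ (ModuleCat.of R (R ⧸ I)) Y j := by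
  induction j using Nat.strong_induction_on with
  | _ j ih =>
    rcases j with _ | _ | j
    · exact h0
    · exact h1
    intro e
    let t : (R ⧸ I ^ 1) →ₗ[R] (R ⧸ I) :=
      Submodule.mapQ _ _ LinearMap.id (by intro x hx; simpa using hx)
    obtain ⟨m, hm, h⟩ := hV (j+2) (by omega) 1 ((Abelian.Ext.mk₀ (ModuleCat.ofHom t)).comp e (zero_add _))
    let g : (R ⧸ I ^ m) →ₗ[R] (R ⧸ I) := t ∘ₗ (q I hm).hom
    have hg : Function.Surjective g := by
      intro x
      obtain ⟨x, rfl⟩ := Ideal.Quotient.mk_surjective x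
      exact ⟨Ideal.Quotient.mk _ x, rfl⟩
    refine epi_inj (ses_ker g hg) Y _ ?_ e ?_
    · intro k hk
      refine EZ_tors I Y k (fun k' hk' => ih k' (by omega)) (LinearMap.ker g) m ?_
      rintro r hr ⟨x, hx⟩
      apply Subtype.ext
      obtain ⟨x, rfl⟩ := Ideal.Quotient.mk_surjective x
      change r • (Ideal.Quotient.mk (I ^ m) x) = 0
      rw [Algebra.smul_def]
      change Ideal.Quotient.mk (I ^ m) r * _ = 0
      rw [Ideal.Quotient.eq_zero_iff_mem.2 hr, zero_mul]
    · rw [Abelian.Ext.mk₀_comp_mk₀_assoc] at h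
      exact h

lemma V_of_EZ [IsNoetherianRing R] (I : Ideal R) (Y : ModuleCat.{u} R)
    (h : ∀ j, EZ (ModuleCat.of R (R ⧸ I)) Y j) (j : ℕ) : V I j Y := by
  intro n e
  refine ⟨n, le_rfl, ?_⟩
  rw [EZ_tors I Y j (fun k _ => h k) (R ⧸ I ^ n) n ?_ e, Abelian.Ext.comp_zero]
  rintro r hr x
  obtain ⟨x, rfl⟩ := Ideal.Quotient.mk_surjective x
  rw [Algebra.smul_def]
  change Ideal.Quotient.mk (I ^ n) r * _ = 0
  rw [Ideal.Quotient.eq_zero_iff_mem.2 hr, zero_mul]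
lemma cov3 {S : ShortComplex (ModuleCat.{u} R)} (hS : S.ShortExact) (X : ModuleCat.{u} R) (j : ℕ)
    (h1 : EZ X S.X₁ (j+1)) (h2 : EZ X S.X₂ j) : EZ X S.X₃ j := by
  intro x
  obtain ⟨y, hy⟩ := Abelian.Ext.covariant_sequence_exact₃ _ hS x rfl (h1 _)
  rw [← hy, h2 y, Abelian.Ext.zero_comp]

lemma cov1 {S : ShortComplex (ModuleCat.{u} R)} (hS : S.ShortExact) (X : ModuleCat.{u} R) (j : ℕ)
    (h3 : EZ X S.X₃ j) (h2 : EZ X S.X₂ (j+1)) : EZ X S.X₁ (j+1) := by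
  intro x
  obtain ⟨y, hy⟩ := Abelian.Ext.covariant_sequence_exact₁ _ hS x (h2 _) rfl
  rw [← hy, h3 y, Abelian.Ext.zero_comp]

lemma EZ_inj (X J : ModuleCat.{u} R) [Injective J] (j : ℕ) : EZ X J (j+1) :=
  fun e => Abelian.Ext.eq_zero_of_injective e

lemma V_one {S : ShortComplex (ModuleCat.{u} R)} (hS : S.ShortExact) (I : Ideal R)
    (hJ : Injective S.X₂) (h : ∀ n, ∀ φ : Q I n ⟶ S.X₃, ∃ m, ∃ h : n ≤ m, ∃ ψ : Q I m ⟶ S.X₂,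
      q I h ≫ φ = ψ ≫ S.g) : V I 1 S.X₁ := by
  intro n e
  obtain ⟨x, rfl⟩ := Abelian.Ext.covariant_sequence_exact₁ (Q I n) hS e
    (Abelian.Ext.eq_zero_of_injective _) (zero_add 1)
  obtain ⟨φ, rfl⟩ := (Abelian.Ext.mk₀_bijective _ _).2 x
  obtain ⟨m, hm, ψ, key⟩ := h n φ
  refine ⟨m, hm, ?_⟩
  rw [Abelian.Ext.mk₀_comp_mk₀_assoc, key, ← Abelian.Ext.mk₀_comp_mk₀_assoc, hS.comp_extClass,
      Abelian.Ext.comp_zero]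

def tor (I : Ideal R) {M : Type u} [AddCommGroup M] [Module R M] (x : M) : Prop :=
  ∃ n : ℕ, ∀ r ∈ I ^ n, r • x = 0

def gam (I : Ideal R) (M : Type u) [AddCommGroup M] [Module R M] : Submodule R M where
  carrier := {x | tor I x}
  zero_mem' := ⟨0, fun r _ => smul_zero r⟩
  add_mem' := by
    rintro a b ⟨n, hn⟩ ⟨m, hm⟩
    refine ⟨n + m, fun r hr => ?_⟩
    rw [smul_add, hn r (Ideal.pow_le_pow_right (by omega) hr),
      hm r (Ideal.pow_le_pow_right (by omega) hr), add_zero]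
  smul_mem' := by
    rintro c x ⟨n, hn⟩
    exact ⟨n, fun r hr => by rw [smul_comm, hn r hr, smul_zero]⟩

lemma tor_map (I : Ideal R) {M N : Type u} [AddCommGroup M] [Module R M] [AddCommGroup N]
    [Module R N] (f : M →ₗ[R] N) (x : M) (h : tor I x) : tor I (f x) := by
  obtain ⟨n, hn⟩ := h
  exact ⟨n, fun r hr => by rw [← map_smul, hn r hr, map_zero]⟩

lemma tor_of_inj (I : Ideal R) {M N : Type u} [AddCommGroup M] [Module R M] [AddCommGroup N]
    [Module R N] (f : M →ₗ[R] N) (hf : Function.Injective f) (x : M) (h : tor I (f x)) :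
    tor I x := by
  obtain ⟨n, hn⟩ := h
  exact ⟨n, fun r hr => hf (by rw [map_smul, hn r hr, map_zero])⟩

lemma unif (I : Ideal R) (N : Type u) [AddCommGroup N] [Module R N] [Module.Finite R N]
    (h : ∀ x : N, tor I x) : ∃ k : ℕ, ∀ x : N, ∀ r ∈ I ^ k, r • x = 0 := by
  obtain ⟨s, hs⟩ := Module.Finite.fg_top (R := R) (M := N)
  choose f hf using h
  refine ⟨s.sup f, fun x r hr => ?_⟩
  have : x ∈ Submodule.span R (s : Set N) := hs ▸ Submodule.mem_top
  induction this using Submodule.span_induction with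
  | mem x hx => exact hf x r (Ideal.pow_le_pow_right (Finset.le_sup hx) hr)
  | zero => simp
  | add x y _ _ hx hy => rw [smul_add, hx, hy, add_zero]
  | smul a x _ hx => rw [smul_comm, hx, smul_zero]

lemma gam_inj [IsNoetherianRing R] (I : Ideal R) (E : Type u) [AddCommGroup E] [Module R E]
    (hE : Module.Injective R E) : Module.Injective R (gam I E) := by
  apply Module.Baer.injective
  intro J g
  obtain ⟨k, hk⟩ := unif I (LinearMap.range g) (by
    rintro ⟨_, ⟨x, rfl⟩⟩
    exact tor_of_inj I ((gam I E).subtype ∘ₗ (LinearMap.range g).subtype)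
      ((Submodule.subtype_injective _).comp (Submodule.subtype_injective _)) _ (g x).2)
  obtain ⟨k0, hk0⟩ := Ideal.exists_pow_inf_eq_pow_smul (M := R) I J
  let n := k0 + k
  let p : J →ₗ[R] (R ⧸ I ^ n) := (Submodule.mkQ (I ^ n)) ∘ₗ J.subtype
  have hker : LinearMap.ker p ≤ LinearMap.ker g := by
    rintro ⟨x, hx⟩ h
    have h1 : x ∈ I ^ n := (Submodule.Quotient.mk_eq_zero _).1 h
    have h2 : x ∈ I ^ n • (⊤ : Ideal R) ⊓ J := ⟨by simpa using h1, hx⟩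
    rw [hk0 n (by omega), show n - k0 = k by omega] at h2
    have h3 : x ∈ I ^ k • J := Submodule.smul_mono le_rfl inf_le_right h2
    have h4 : (⟨x, hx⟩ : J) ∈ I ^ k • (⊤ : Submodule R J) := by
      have : I ^ k • J = (I ^ k • (⊤ : Submodule R J)).map J.subtype := by
        rw [Submodule.map_smul'', Submodule.map_top, Submodule.range_subtype]
      rw [this] at h3
      obtain ⟨y, hy, rfl⟩ := h3
      exact hy
    have : I ^ k • (⊤ : Submodule R J) ≤ LinearMap.ker g := by
      rw [Submodule.smul_le]
      rintro r hr y -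
      rw [LinearMap.mem_ker, map_smul]
      exact congrArg Subtype.val (hk ⟨g y, ⟨y, rfl⟩⟩ r hr)
    exact this h4
  obtain ⟨h, hh⟩ := hE.out ((LinearMap.ker p).liftQ p le_rfl)
    (by rw [← LinearMap.ker_eq_bot]; exact Submodule.ker_liftQ_eq_bot _ _ _ le_rfl)
    ((gam I E).subtype ∘ₗ (LinearMap.ker p).liftQ g hker)
  refine ⟨(h ∘ₗ (Submodule.mkQ (I ^ n))).codRestrict (gam I E) ?_, ?_⟩
  · intro c
    refine ⟨n, fun r hr => ?_⟩
    rw [LinearMap.comp_apply, ← map_smul, ← map_smul]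
    rw [show (Submodule.mkQ (I^n)) (r • c) = 0 from
      (Submodule.Quotient.mk_eq_zero _).2 (Ideal.mul_mem_right _ _ hr), map_zero]
  · intro x hx
    apply Subtype.ext
    exact hh ((LinearMap.ker p).mkQ ⟨x, hx⟩)

lemma quot_tf [IsNoetherianRing R] (I : Ideal R) (E : Type u) [AddCommGroup E] [Module R E]
    (x : E ⧸ gam I E) (hx : tor I x) : x = 0 := by
  obtain ⟨x, rfl⟩ := Submodule.mkQ_surjective _ x
  obtain ⟨n, hn⟩ := hx
  refine (Submodule.Quotient.mk_eq_zero _).2 ?_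
  obtain ⟨k, hk⟩ := unif I (Submodule.map (LinearMap.toSpanSingleton R E x) (I ^ n : Ideal R)) (by
    rintro ⟨_, ⟨r, hr, rfl⟩⟩
    have := hn r hr
    rw [← map_smul] at this
    exact tor_of_inj I (Submodule.subtype _) (Submodule.subtype_injective _) _
      ((Submodule.Quotient.mk_eq_zero _).1 this))
  refine ⟨k + n, fun r hr => ?_⟩
  rw [pow_add] at hr
  induction hr using Submodule.mul_induction_on' with
  | mem_mul_mem a ha b hb =>
    rw [mul_smul]
    exact congrArg Subtype.val (hk ⟨b • x, ⟨b, hb, rfl⟩⟩ a ha)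
  | add a _ b _ h1 h2 => rw [add_smul, h1, h2, add_zero]

lemma quot_inj [IsNoetherianRing R] (I : Ideal R) (E : Type u) [AddCommGroup E] [Module R E]
    (hE : Module.Injective R E) : Module.Injective R (E ⧸ gam I E) := by
  obtain ⟨p, hp⟩ := (gam_inj I E hE).out (gam I E).subtype (Submodule.subtype_injective _)
    LinearMap.id
  let s : (E ⧸ gam I E) →ₗ[R] E := (gam I E).liftQ (LinearMap.id - (gam I E).subtype ∘ₗ p) (by
    intro x hx
    have := hp ⟨x, hx⟩
    simp only [LinearMap.mem_ker, LinearMap.sub_apply, LinearMap.comp_apply]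
    change x - (p x : E) = 0
    rw [show p x = ⟨x, hx⟩ from this, sub_self])
  have hs : ∀ x, (gam I E).mkQ (s x) = x := by
    intro x
    obtain ⟨x, rfl⟩ := Submodule.mkQ_surjective _ x
    change (gam I E).mkQ (x - (p x : E)) = _
    rw [map_sub, show (gam I E).mkQ (p x : E) = 0 from
      (Submodule.Quotient.mk_eq_zero _).2 (p x).2, sub_zero]
  constructor
  intro X Y _ _ _ _ f hf g
  obtain ⟨h, hh⟩ := hE.out f hf (s ∘ₗ g)
  refine ⟨(gam I E).mkQ ∘ₗ h, fun x => ?_⟩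
  rw [LinearMap.comp_apply, hh]
  exact hs _

lemma exInj (M : Type u) [AddCommGroup M] [Module R M] :
    ∃ (E : Type u) (_ : AddCommGroup E) (_ : Module R E) (f : M →ₗ[R] E),
      Module.Injective R E ∧ Function.Injective f := by
  refine ⟨(Injective.under (ModuleCat.of R M) : ModuleCat.{u} R), inferInstance, inferInstance,
    (Injective.ι (ModuleCat.of R M)).hom, ?_, ?_⟩
  · rw [Module.injective_iff_injective_object]
    exact inferInstanceAs (Injective (Injective.under (ModuleCat.of R M)))
  · exact (ModuleCat.mono_iff_injective _).1 inferInstance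

lemma exE [IsNoetherianRing R] (I : Ideal R) (M : Type u) [AddCommGroup M] [Module R M] :
    ∃ (E : Type u) (_ : AddCommGroup E) (_ : Module R E) (f : M →ₗ[R] E),
      Module.Injective R E ∧ (∀ x : E, tor I x → x = 0) ∧ (∀ x, f x = 0 → tor I x) := by
  obtain ⟨E, _, _, f, hE, hf⟩ := exInj (R := R) M
  refine ⟨E ⧸ gam I E, inferInstance, inferInstance, (gam I E).mkQ ∘ₗ f, quot_inj I E hE,
    quot_tf I E, fun x hx => tor_of_inj I f hf x ?_⟩
  exact (Submodule.Quotient.mk_eq_zero _).1 hx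

lemma V_tor [IsNoetherianRing R] (I : Ideal R) (j : ℕ) : ∀ (T : Type u) [AddCommGroup T]
    [Module R T] (_ : ∀ x : T, tor I x), V I (j+1) (ModuleCat.of R T) := by
  induction j with
  | zero => ?_
  | succ j ih => ?_
  all_goals
    intro T _ _ hT
    obtain ⟨E, _, _, f0, hE, hf0⟩ := exInj (R := R) T
    let f : T →ₗ[R] gam I E := f0.codRestrict _ (fun x => tor_map I f0 x (hT x))
    have hf : Function.Injective f := fun a b h => hf0 (congrArg Subtype.val h)
    have hS := ses f (LinearMap.range f).mkQ (LinearMap.exact_map_mkQ_range f) hf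
      (Submodule.mkQ_surjective _)
    have hJ : Injective (ModuleCat.of R (gam I E)) :=
      (Module.injective_iff_injective_object R _).1 (gam_inj I E hE)
    have htor : ∀ x : gam I E, tor I x := fun x =>
      tor_of_inj I (gam I E).subtype (Submodule.subtype_injective _) _ x.2
  · refine V_one hS I hJ fun n φ => ?_
    let φ' : (R ⧸ I ^ n) →ₗ[R] (gam I E ⧸ LinearMap.range f) := φ.hom
    obtain ⟨y, hy⟩ := Submodule.mkQ_surjective (LinearMap.range f) (φ' (Submodule.Quotient.mk 1))
    obtain ⟨m, hm⟩ := htor y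
    let ψ : (R ⧸ I ^ (m + n)) →ₗ[R] gam I E :=
      Submodule.liftQ (I ^ (m + n)) (LinearMap.toSpanSingleton R _ y)
        (fun r hr => hm r (Ideal.pow_le_pow_right (by omega) hr))
    refine ⟨m + n, by omega, ModuleCat.ofHom ψ, ?_⟩
    apply ModuleCat.hom_ext
    apply LinearMap.ext
    intro r
    obtain ⟨r, rfl⟩ := Ideal.Quotient.mk_surjective r
    change φ' (Submodule.Quotient.mk r) = (LinearMap.range f).mkQ (r • y)
    rw [map_smul, hy, ← map_smul, ← Submodule.Quotient.mk_smul, smul_eq_mul, mul_one]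
  · refine V_left hS I (j+1) (@V_inj _ _ I (j+1) _ hJ) (ih _ ?_)
    intro x
    obtain ⟨x, rfl⟩ := Submodule.mkQ_surjective _ x
    exact tor_map I _ x (htor x)

lemma EZ0_iff (I : Ideal R) (M : Type u) [AddCommGroup M] [Module R M] :
    EZ (ModuleCat.of R (R ⧸ I)) (ModuleCat.of R M) 0 ↔
      ∀ x : M, (∀ r ∈ I, r • x = 0) → x = 0 := by
  rw [EZ_zero_iff]
  constructor
  · intro h x hx
    have := h (Submodule.liftQ I (LinearMap.toSpanSingleton R _ x) (fun r hr => hx r hr))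
    have := LinearMap.congr_fun this (Submodule.Quotient.mk 1)
    change (1 : R) • x = 0 at this
    simpa using this
  · intro h f
    apply LinearMap.ext
    intro x
    refine h _ fun r hr => ?_
    rw [← map_smul]
    obtain ⟨x, rfl⟩ := Ideal.Quotient.mk_surjective x
    rw [show r • (Ideal.Quotient.mk I x) = 0 from ?_, map_zero]
    rw [Algebra.smul_def]
    change Ideal.Quotient.mk I r * _ = 0
    rw [Ideal.Quotient.eq_zero_iff_mem.2 hr, zero_mul]

lemma EZ0_iff_tor (I : Ideal R) (M : Type u) [AddCommGroup M] [Module R M] :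
    EZ (ModuleCat.of R (R ⧸ I)) (ModuleCat.of R M) 0 ↔ ∀ x : M, tor I x → x = 0 := by
  rw [EZ0_iff]
  constructor
  · rintro h x ⟨n, hn⟩
    induction n generalizing x with
    | zero => simpa using hn 1 (by simp)
    | succ n ih =>
      refine ih _ fun r hr => h _ fun s hs => ?_
      rw [← mul_smul]
      exact hn _ (by rw [pow_succ']; exact Ideal.mul_mem_mul hs hr)
  · exact fun h x hx => h x ⟨1, by simpa using hx⟩

lemma exS [IsNoetherianRing R] (I : Ideal R) :
    ∃ (S : Type u) (_ : AddCommGroup S) (_ : Module R S) (f : R →ₗ[R] S),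
      (∀ x, f x = 0 → tor I x) ∧ (∀ x : S ⧸ LinearMap.range f, tor I x) ∧
      EZ (ModuleCat.of R (R ⧸ I)) (ModuleCat.of R S) 0 ∧
      EZ (ModuleCat.of R (R ⧸ I)) (ModuleCat.of R S) 1 := by
  obtain ⟨E, _, _, f, hE, htf, hker⟩ := exE I R
  let S : Submodule R E := (gam I (E ⧸ LinearMap.range f)).comap (LinearMap.range f).mkQ
  have hmem : ∀ x, f x ∈ S := by
    intro x
    change tor I ((LinearMap.range f).mkQ (f x))
    rw [show (LinearMap.range f).mkQ (f x) = 0 from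
      (Submodule.Quotient.mk_eq_zero _).2 ⟨x, rfl⟩]
    exact ⟨0, fun r _ => smul_zero r⟩
  refine ⟨S, inferInstance, inferInstance, f.codRestrict S hmem, ?_, ?_, ?_, ?_⟩
  · intro x hx
    exact hker x (congrArg Subtype.val hx)
  · intro x
    obtain ⟨⟨x, n, hx⟩, rfl⟩ := Submodule.mkQ_surjective _ x
    refine ⟨n, fun r hr => ?_⟩
    rw [← map_smul]
    refine (Submodule.Quotient.mk_eq_zero _).2 ?_
    have := hx r hr
    rw [← map_smul] at this
    obtain ⟨y, hy⟩ := (Submodule.Quotient.mk_eq_zero _).1 this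
    exact ⟨y, Subtype.ext hy⟩
  · rw [EZ0_iff_tor]
    exact fun x hx => Subtype.ext (htf _ (tor_map I S.subtype x hx))
  · have hJ : Injective (ModuleCat.of R E) := (Module.injective_iff_injective_object R _).1 hE
    have h0 : EZ (ModuleCat.of R (R ⧸ I)) (ModuleCat.of R (E ⧸ S)) 0 := by
      rw [EZ0_iff_tor]
      intro x hx
      obtain ⟨x, rfl⟩ := Submodule.mkQ_surjective _ x
      refine (Submodule.Quotient.mk_eq_zero _).2 ?_
      have := quot_tf I _ ((gam I (E ⧸ LinearMap.range f)).mkQ ((LinearMap.range f).mkQ x)) ?_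
      · exact (Submodule.Quotient.mk_eq_zero (gam I (E ⧸ LinearMap.range f))).1 this
      obtain ⟨n, hn⟩ := hx
      refine ⟨n, fun r hr => ?_⟩
      have := hn r hr
      rw [← map_smul] at this
      rw [← map_smul, ← map_smul]
      refine (Submodule.Quotient.mk_eq_zero _).2 ?_
      exact (Submodule.Quotient.mk_eq_zero S).1 this
    exact cov1 (ses_mkQ S) _ 0 h0 (@EZ_inj _ _ _ _ hJ 0)

lemma exHom [IsNoetherianRing R] (I : Ideal R) (S : Type u) [AddCommGroup S] [Module R S]
    (f : R →ₗ[R] S) (hk : ∀ x, f x = 0 → tor I x) (hc : ∀ x : S ⧸ LinearMap.range f, tor I x)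
    (M : Type u) [AddCommGroup M] [Module R M]
    (h0 : EZ (ModuleCat.of R (R ⧸ I)) (ModuleCat.of R M) 0)
    (h1 : EZ (ModuleCat.of R (R ⧸ I)) (ModuleCat.of R M) 1) (m : M) :
    ∃! h : S →ₗ[R] M, h (f 1) = m := by
  rw [EZ0_iff_tor] at h0
  have hcs : ∀ s : S, ∃ n : ℕ, ∀ r ∈ I ^ n, ∃ a, f a = r • s := by
    intro s
    obtain ⟨n, hn⟩ := hc (Submodule.mkQ _ s)
    refine ⟨n, fun r hr => ?_⟩
    have := hn r hr
    rw [← map_smul] at this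
    exact (Submodule.Quotient.mk_eq_zero _).1 this
  refine existsUnique_of_exists_of_unique ?_ ?_
  · obtain ⟨E, _, _, g, hE, htf, hker⟩ := exE I M
    have hg : Function.Injective g := by
      rw [injective_iff_map_eq_zero]
      exact fun x hx => h0 x (hker x hx)
    have hq : EZ (ModuleCat.of R (R ⧸ I)) (ModuleCat.of R (E ⧸ LinearMap.range g)) 0 := by
      have hS := ses g (LinearMap.range g).mkQ (LinearMap.exact_map_mkQ_range g) hg
        (Submodule.mkQ_surjective _)
      exact cov3 hS _ 0 h1 ((EZ0_iff_tor I E).2 htf)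
    rw [EZ0_iff_tor] at hq
    obtain ⟨h, hh⟩ := hE.out ((LinearMap.ker f).liftQ f le_rfl)
      (by rw [← LinearMap.ker_eq_bot]; exact Submodule.ker_liftQ_eq_bot _ _ _ le_rfl)
      ((LinearMap.ker f).liftQ (LinearMap.toSpanSingleton R E (g m)) (by
        intro r hr
        exact htf _ (tor_map I (LinearMap.toSpanSingleton R E (g m)) r (hk r hr))))
    have hh' : ∀ r, h (f r) = g (r • m) := by
      intro r
      rw [map_smul]
      exact hh (Submodule.Quotient.mk r)
    have hmem : ∀ s, h s ∈ LinearMap.range g := by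
      intro s
      refine (Submodule.Quotient.mk_eq_zero _).1 (hq ((LinearMap.range g).mkQ (h s)) ?_)
      obtain ⟨n, hn⟩ := hcs s
      refine ⟨n, fun r hr => ?_⟩
      obtain ⟨a, ha⟩ := hn r hr
      rw [← map_smul, ← map_smul, ← ha, hh']
      exact (Submodule.Quotient.mk_eq_zero _).2 ⟨_, rfl⟩
    refine ⟨(LinearEquiv.ofInjective g hg).symm.toLinearMap ∘ₗ
      h.codRestrict (LinearMap.range g) hmem, ?_⟩
    change (LinearEquiv.ofInjective g hg).symm (h.codRestrict (LinearMap.range g) hmem (f 1)) = m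
    rw [LinearEquiv.symm_apply_eq]
    apply Subtype.ext
    change h (f 1) = g m
    rw [hh', one_smul]
  · intro a b ha hb
    apply LinearMap.ext
    intro s
    rw [← sub_eq_zero, ← LinearMap.sub_apply]
    obtain ⟨n, hn⟩ := hcs s
    refine h0 _ ⟨n, fun r hr => ?_⟩
    obtain ⟨c, hc⟩ := hn r hr
    rw [← map_smul, ← hc, show c = c • 1 by simp, map_smul, map_smul, LinearMap.sub_apply, ha, hb,
      sub_self, smul_zero]

lemma EZ_of_ideal [IsNoetherianRing R] (I : Ideal R) (S : Type u) [AddCommGroup S] [Module R S]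
    (f : R →ₗ[R] S) (hk : ∀ x, f x = 0 → tor I x) (hc : ∀ x : S ⧸ LinearMap.range f, tor I x)
    (hI : f 1 ∈ I • (⊤ : Submodule R S))
    (M : Type u) [AddCommGroup M] [Module R M]
    (h0 : EZ (ModuleCat.of R (R ⧸ I)) (ModuleCat.of R M) 0)
    (h1 : EZ (ModuleCat.of R (R ⧸ I)) (ModuleCat.of R M) 1) (j : ℕ) :
    EZ (ModuleCat.of R (R ⧸ I)) (ModuleCat.of R M) j := by
  have hex := exHom I S f hk hc M h0 h1
  choose F hF hF' using hex
  let u : S → (M →ₗ[R] M) := fun s =>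
    { toFun := fun m => F m s
      map_add' := fun a b => by
        have := hF' (a + b) (F a + F b) (by simp [hF])
        simp [← this]
      map_smul' := fun a b => by
        have := hF' (a • b) (a • F b) (by simp [hF])
        simp [← this] }
  intro e
  have key : ∀ s ∈ I • (⊤ : Submodule R S),
      e.comp (Abelian.Ext.mk₀ (ModuleCat.ofHom (u s))) (add_zero j) = 0 := by
    intro s hs
    induction hs using Submodule.smul_induction_on' with
    | smul r hr s hs =>
      have h1 : u (r • s) = r • u s := by
        ext m; simp [u]
      have h2 : r • e = 0 := by
        have : r • (𝟙 (ModuleCat.of R (R ⧸ I))) = 0 := by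
          apply ModuleCat.hom_ext
          apply LinearMap.ext
          intro x
          obtain ⟨x, rfl⟩ := Ideal.Quotient.mk_surjective x
          change r • (Ideal.Quotient.mk I x) = 0
          rw [Algebra.smul_def]
          change Ideal.Quotient.mk I r * _ = 0
          rw [Ideal.Quotient.eq_zero_iff_mem.2 hr, zero_mul]
        rw [← Abelian.Ext.mk₀_id_comp e, ← Abelian.Ext.smul_comp, ← Abelian.Ext.mk₀_smul, this,
          Abelian.Ext.mk₀_zero, Abelian.Ext.zero_comp]
      rw [h1, show ModuleCat.ofHom (r • u s) = r • ModuleCat.ofHom (u s) from rfl,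
        Abelian.Ext.mk₀_smul, Abelian.Ext.comp_smul, ← Abelian.Ext.smul_comp, h2,
        Abelian.Ext.zero_comp]
    | add a _ b _ ha hb =>
      have h1 : u (a + b) = u a + u b := by
        ext m; simp [u]
      rw [h1, show ModuleCat.ofHom (u a + u b) = ModuleCat.ofHom (u a) + ModuleCat.ofHom (u b)
        from rfl, Abelian.Ext.mk₀_add, Abelian.Ext.comp_add, ha, hb, add_zero]
  have := key _ hI
  rw [show ModuleCat.ofHom (u (f 1)) = 𝟙 (ModuleCat.of R M) from ?_, Abelian.Ext.comp_mk₀_id]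
    at this
  · exact this
  · apply ModuleCat.hom_ext
    apply LinearMap.ext
    intro m
    exact hF m
lemma shiftDown {S : ShortComplex (ModuleCat.{u} R)} (hS : S.ShortExact) (hP : Projective S.X₂)
    (Y : ModuleCat.{u} R) (j : ℕ) (h : EZ S.X₃ Y (j+2)) : EZ S.X₁ Y (j+1) := by
  intro e
  obtain ⟨x, hx⟩ := Abelian.Ext.contravariant_sequence_exact₁ hS Y e (n₁ := j+2) (by omega) (h _)
  rw [← hx, Abelian.Ext.eq_zero_of_projective x, Abelian.Ext.comp_zero]

lemma shiftUp {S : ShortComplex (ModuleCat.{u} R)} (hS : S.ShortExact) (hP : Projective S.X₂)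
    (Y : ModuleCat.{u} R) (j : ℕ) (h : EZ S.X₁ Y (j+1)) : EZ S.X₃ Y (j+2) := by
  intro e
  obtain ⟨x, hx⟩ := Abelian.Ext.contravariant_sequence_exact₃ hS Y e
    (Abelian.Ext.eq_zero_of_projective _) (n₀ := j+1) (by omega)
  rw [← hx, h x, Abelian.Ext.comp_zero]

lemma ext1_iff {S : ShortComplex (ModuleCat.{u} R)} (hS : S.ShortExact) (hP : Projective S.X₂)
    (Y : ModuleCat.{u} R) : EZ S.X₃ Y 1 ↔ ∀ φ : S.X₁ ⟶ Y, ∃ ψ : S.X₂ ⟶ Y, S.f ≫ ψ = φ := by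
  constructor
  · intro h φ
    obtain ⟨x, hx⟩ := Abelian.Ext.contravariant_sequence_exact₁ hS Y (Abelian.Ext.mk₀ φ)
      (n₁ := 1) (by omega) (h _)
    obtain ⟨ψ, rfl⟩ := (Abelian.Ext.mk₀_bijective _ _).2 x
    rw [Abelian.Ext.mk₀_comp_mk₀] at hx
    exact ⟨ψ, (Abelian.Ext.mk₀_bijective _ _).1 hx⟩
  · intro h e
    obtain ⟨x, hx⟩ := Abelian.Ext.contravariant_sequence_exact₃ hS Y e
      (Abelian.Ext.eq_zero_of_projective _) (n₀ := 0) (by omega)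
    obtain ⟨φ, rfl⟩ := (Abelian.Ext.mk₀_bijective _ _).2 x
    obtain ⟨ψ, rfl⟩ := h φ
    rw [← hx, ← Abelian.Ext.mk₀_comp_mk₀, hS.extClass_comp_assoc]

lemma EZ_dsum [IsNoetherianRing R] (M : Type u) [AddCommGroup M] [Module R M] (i : ℕ) :
    ∀ (N : Type u) [AddCommGroup N] [Module R N] [Module.Finite R N]
      (_ : EZ (ModuleCat.of R N) (ModuleCat.of R M) i),
      EZ (ModuleCat.of R N) (ModuleCat.of R (ℕ →₀ M)) i := by
  induction i with
  | zero =>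
    intro N _ _ _ h
    rw [EZ_zero_iff] at h ⊢
    intro f
    apply LinearMap.ext
    intro x
    apply Finsupp.ext
    intro k
    exact LinearMap.congr_fun (h (Finsupp.lapply k ∘ₗ f)) x
  | succ i ih =>
    intro N _ _ _ h
    obtain ⟨n, p, hp⟩ := Module.Finite.exists_fin' R N
    have hS := ses_ker p hp
    have hP : Projective (ModuleCat.of R (Fin n → R)) :=
      (IsProjective.iff_projective (Fin n → R)).1 inferInstance
    cases i with
    | succ i => exact shiftUp hS hP _ i (ih _ (shiftDown hS hP _ i h))
    | zero =>
      refine (ext1_iff hS hP _).2 ?_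
      have h' := (ext1_iff hS hP _).1 h
      intro φ0
      let φ : LinearMap.ker p →ₗ[R] (ℕ →₀ M) := φ0.hom
      have ex : ∀ k, ∃ ψ : (Fin n → R) →ₗ[R] M, ∀ x : LinearMap.ker p, ψ x = φ x k := by
        intro k
        obtain ⟨ψ, hψ⟩ := h' (ModuleCat.ofHom (Finsupp.lapply k ∘ₗ φ))
        refine ⟨ψ.hom, fun x => ?_⟩
        exact LinearMap.congr_fun (congrArg ModuleCat.Hom.hom hψ) x
      choose ψ hψ using ex
      obtain ⟨t, ht⟩ : ∃ t : Finset ℕ, ∀ x, (φ x).support ⊆ t := by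
        classical
        obtain ⟨s, hs⟩ := Module.Finite.fg_top (R := R) (M := LinearMap.ker p)
        refine ⟨s.biUnion fun x => (φ x).support, fun x => ?_⟩
        have : x ∈ Submodule.span R (s : Set (LinearMap.ker p)) := hs ▸ Submodule.mem_top
        induction this using Submodule.span_induction with
        | mem x hx => exact Finset.subset_biUnion_of_mem (fun x => (φ x).support) hx
        | zero => simp
        | add x y _ _ hx hy =>
          rw [map_add]
          exact Finsupp.support_add.trans (Finset.union_subset hx hy)
        | smul a x _ hx =>
          rw [map_smul]
          exact Finsupp.support_smul.trans hx
      refine ⟨ModuleCat.ofHom (∑ k ∈ t, Finsupp.lsingle k ∘ₗ ψ k), ?_⟩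
      apply ModuleCat.hom_ext
      apply LinearMap.ext
      intro (x : LinearMap.ker p)
      change (∑ k ∈ t, Finsupp.lsingle k ∘ₗ ψ k) (x : Fin n → R) = φ x
      rw [LinearMap.sum_apply]
      apply Finsupp.ext
      intro l
      rw [Finsupp.finsetSum_apply]
      simp only [LinearMap.comp_apply, Finsupp.lsingle_apply, hψ]
      by_cases hl : l ∈ t
      · rw [Finset.sum_eq_single l]
        · simp
        · intro b _ hb
          simp [hb]
        · exact fun h => (h hl).elim
      · rw [Finset.sum_eq_zero]
        · by_contra hne
          exact hl (ht x (Finsupp.mem_support_iff.2 (Ne.symm hne)))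
        · intro b hb
          have : b ≠ l := by rintro rfl; exact hl hb
          simp [this]

lemma EZ_congr (X : ModuleCat.{u} R) (M N : Type u) [AddCommGroup M] [Module R M]
    [AddCommGroup N] [Module R N] (e : M ≃ₗ[R] N) (i : ℕ) (h : EZ X (ModuleCat.of R M) i) :
    EZ X (ModuleCat.of R N) i := by
  intro x
  have : ModuleCat.ofHom e.symm.toLinearMap ≫ ModuleCat.ofHom e.toLinearMap = 𝟙 _ := by
    apply ModuleCat.hom_ext
    apply LinearMap.ext
    intro x
    exact e.apply_symm_apply x
  rw [← Abelian.Ext.comp_mk₀_id x, ← this, ← Abelian.Ext.mk₀_comp_mk₀,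
    ← Abelian.Ext.comp_assoc _ _ _ (add_zero _) _ (by omega), h (x.comp _ _),
    Abelian.Ext.zero_comp]

open Polynomial in
lemma mccoy {A S : Type u} [CommRing A] [AddCommGroup S] [Module A S] (f : A[X])
    (h : ∀ s : S, (∀ i, f.coeff i • s = 0) → s = 0) (N : ℕ) :
    ∀ (g : PolynomialModule A S) (_ : ∀ k ≥ N, g.coeff k = 0) (_ : f • g = 0), g = 0 := by
  induction N with
  | zero =>
    intro g hg _
    rw [← PolynomialModule.coeff_inj]
    exact Finsupp.ext fun k => hg k (Nat.zero_le _)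
  | succ N ih =>
    intro g hg hfg
    have key : ∀ k i, f.natDegree + 1 ≤ i + k → f.coeff i • g = 0 := by
      intro k
      induction k with
      | zero =>
        intro i hi
        rw [coeff_eq_zero_of_natDegree_lt (by omega), zero_smul]
      | succ k ihk =>
        intro i hi
        apply ih
        · intro l hl
          change f.coeff i • g.coeff l = 0
          rcases Nat.lt_or_ge N l with h1 | h1
          · rw [hg l h1, smul_zero]
          obtain rfl : l = N := le_antisymm h1 hl
          have h2 : (f • g).coeff (i + l) = 0 := by rw [hfg]; rfl
          rw [PolynomialModule.smul_apply, Finset.sum_eq_single (i, l)] at h2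
          · exact h2
          · rintro ⟨a, b⟩ hab hne
            rw [Finset.HasAntidiagonal.mem_antidiagonal] at hab
            simp only at hab ⊢
            rcases lt_trichotomy a i with h3 | h3 | h3
            · rw [hg b (by omega), smul_zero]
            · exact (hne (by subst h3; congr 1; omega)).elim
            · have := ihk a (by omega)
              exact congrArg (fun z => z.coeff b) this
          · intro h3
            exact (h3 (by simp)).elim
        · rw [smul_comm, hfg, smul_zero]
    rw [← PolynomialModule.coeff_inj]
    refine Finsupp.ext fun b => h _ fun i => ?_
    exact congrArg (fun z => z.coeff b) (key (f.natDegree + 1) i (by omega))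

lemma smul_mem_of_map (I : Ideal R) {A S : Type u} [CommRing A] [Algebra R A]
    [AddCommGroup S] [Module R S] [Module A S] [IsScalarTower R A S] (a : A)
    (ha : a ∈ I.map (algebraMap R A)) (s : S) : a • s ∈ I • (⊤ : Submodule R S) := by
  induction ha using Submodule.span_induction generalizing s with
  | mem x hx =>
    obtain ⟨r, hr, rfl⟩ := hx
    rw [algebraMap_smul]
    exact Submodule.smul_mem_smul hr Submodule.mem_top
  | zero => rw [zero_smul]; exact zero_mem _
  | add x y _ _ hx hy => rw [add_smul]; exact add_mem (hx s) (hy s)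
  | smul b x _ hx => rw [smul_eq_mul, mul_comm, mul_smul]; exact hx _

open Polynomial in
lemma main_ind [IsNoetherianRing R] (I : Ideal R) (n : ℕ) :
    ∀ (A S : Type u) [CommRing A] [Algebra R A]
      [AddCommGroup S] [Module R S] [Module A S] [IsScalarTower R A S]
      (_ : ∀ i, EZ (ModuleCat.of R (R ⧸ I)) (ModuleCat.of R S) i)
      (y : Fin n → A) (_ : ∀ i, y i ∈ I.map (algebraMap R A))
      (_ : ∀ r ∈ I, algebraMap R A r ∈ Ideal.span (Set.range y) ⊔ Module.annihilator A S)
      (s : S), s ∈ I • (⊤ : Submodule R S) := by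
  have tf : ∀ (m : ℕ) (A S : Type u) [CommRing A] [Algebra R A]
      [AddCommGroup S] [Module R S] [Module A S] [IsScalarTower R A S]
      (_ : ∀ i, EZ (ModuleCat.of R (R ⧸ I)) (ModuleCat.of R S) i)
      (y : Fin m → A)
      (_ : ∀ r ∈ I, algebraMap R A r ∈ Ideal.span (Set.range y) ⊔ Module.annihilator A S)
      (s : S) (_ : ∀ i, y i • s = 0), s = 0 := by
    intro m A S _ _ _ _ _ _ hEZ y hy s hs
    refine (EZ0_iff I S).1 (hEZ 0) s fun r hr => ?_
    have : Ideal.span (Set.range y) ⊔ Module.annihilator A S ≤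
        LinearMap.ker (LinearMap.toSpanSingleton A S s) := by
      refine sup_le (Ideal.span_le.2 ?_) ?_
      · rintro _ ⟨i, rfl⟩
        exact hs i
      · intro a ha
        exact Module.mem_annihilator.1 ha s
    have := this (hy r hr)
    rw [LinearMap.mem_ker, LinearMap.toSpanSingleton_apply, algebraMap_smul] at this
    exact this
  induction n with
  | zero =>
    intro A S _ _ _ _ _ _ hEZ y _ hy s
    rw [tf 0 A S hEZ y hy s (fun i => i.elim0)]
    exact zero_mem _
  | succ n ih =>
    intro A S _ _ _ _ _ _ hEZ y hyI hy s
    let f : A[X] := ∑ i : Fin (n+1), monomial (i : ℕ) (y i)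
    have hf : ∀ i : Fin (n+1), f.coeff i = y i := by
      intro i
      simp [f, coeff_monomial, Fin.val_inj]
    let P := PolynomialModule A S
    let F : P →ₗ[A[X]] P := LinearMap.lsmul A[X] P f
    let N : Submodule A[X] P := LinearMap.range F
    have hinj : Function.Injective (F.restrictScalars R) := by
      rw [injective_iff_map_eq_zero]
      intro g hg
      obtain ⟨b, hb⟩ : ∃ b, ∀ k ≥ b, g.coeff k = 0 := by
        refine ⟨g.coeff.support.sup id + 1, fun k hk => ?_⟩
        by_contra hne
        have := Finset.le_sup (f := id) (Finsupp.mem_support_iff.2 hne)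
        simp only [id] at this
        omega
      refine mccoy f (fun t ht => tf _ A S hEZ y hy t fun i => ?_) b g hb hg
      rw [← hf]; exact ht i
    have hex : Function.Exact (F.restrictScalars R) (N.mkQ.restrictScalars R) := by
      intro z
      exact Submodule.Quotient.mk_eq_zero N
    have hS := ses (F.restrictScalars R) (N.mkQ.restrictScalars R) hex hinj
      (Submodule.mkQ_surjective N)
    have hP : ∀ i, EZ (ModuleCat.of R (R ⧸ I)) (ModuleCat.of R P) i := fun i =>
      EZ_congr _ _ _ (PolynomialModule.coeffLinearEquiv (S := R) A (M := S)).symm i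
        (EZ_dsum S i _ (hEZ i))
    have hQ : ∀ i, EZ (ModuleCat.of R (R ⧸ I)) (ModuleCat.of R (P ⧸ N)) i := fun i =>
      cov3 hS _ i (hP (i+1)) (hP i)
    have key := ih A[X] (P ⧸ N) hQ (fun i => C (y i.succ)) ?_ ?_
      (N.mkQ (PolynomialModule.single A 0 s))
    · have hcoeff : I • (⊤ : Submodule R P) ≤ (I • (⊤ : Submodule R S)).comap
          (Finsupp.lapply 0 ∘ₗ
            (PolynomialModule.coeffLinearEquiv (S := R) A (M := S)).toLinearMap) := by
        rw [Submodule.smul_le]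
        intro r hr z _
        rw [Submodule.mem_comap, map_smul]
        exact Submodule.smul_mem_smul hr Submodule.mem_top
      have e : I • (⊤ : Submodule R (P ⧸ N)) =
          (I • (⊤ : Submodule R P)).map (N.mkQ.restrictScalars R) := by
        rw [Submodule.map_smul'', Submodule.map_top, LinearMap.range_eq_top.2]
        exact Submodule.mkQ_surjective N
      rw [e] at key
      obtain ⟨p, hp, hps⟩ := key
      have hps' : N.mkQ (p - PolynomialModule.single A 0 s) = 0 := by
        rw [map_sub, sub_eq_zero]; exact hps
      obtain ⟨g, hg⟩ := (Submodule.Quotient.mk_eq_zero N).1 hps'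
      have hg' : f • g = p - PolynomialModule.single A 0 s := hg
      have h0 := congrArg (fun z : P => z.coeff 0) hg'
      have h1 : (f • g).coeff 0 = y 0 • g.coeff 0 := by
        rw [PolynomialModule.smul_apply]
        have := hf 0
        simp at this
        simp [this]
      have h2 : s = p.coeff 0 - y 0 • g.coeff 0 := by
        rw [← h1, hg']
        change s = p.coeff 0 - (p.coeff 0 - (Finsupp.single 0 s) 0)
        simp
      rw [h2]
      refine sub_mem ?_ (smul_mem_of_map I _ (hyI 0) _)
      exact hcoeff hp
    · intro i
      rw [show algebraMap R A[X] = C.comp (algebraMap R A) from rfl, ← Ideal.map_map]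
      exact Ideal.mem_map_of_mem _ (hyI _)
    · intro r hr
      have : Ideal.span (Set.range y) ⊔ Module.annihilator A S ≤
          Ideal.comap C (Ideal.span (Set.range fun i : Fin n => (C (y i.succ) : A[X])) ⊔
            Module.annihilator A[X] (P ⧸ N)) := by
        refine sup_le (Ideal.span_le.2 ?_) ?_
        · have hsucc : ∀ i : Fin n, (C (y i.succ) : A[X]) ∈
              Ideal.span (Set.range fun i : Fin n => (C (y i.succ) : A[X])) ⊔
              Module.annihilator A[X] (P ⧸ N) :=
            fun i => Ideal.mem_sup_left (Ideal.subset_span ⟨i, rfl⟩)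
          rintro _ ⟨i, rfl⟩
          refine Fin.cases ?_ (fun i => hsucc i) i
          have hfm : f ∈ Module.annihilator A[X] (P ⧸ N) := by
            rw [Module.mem_annihilator]
            intro z
            obtain ⟨z, rfl⟩ := Submodule.mkQ_surjective N z
            rw [← map_smul]
            exact (Submodule.Quotient.mk_eq_zero N).2 ⟨z, rfl⟩
          have hc : (C (y 0) : A[X]) = f - ∑ i : Fin n, X ^ ((i : ℕ) + 1) * C (y i.succ) := by
            rw [eq_sub_iff_add_eq]
            simp only [f]
            rw [Fin.sum_univ_succ]
            congr 1
            refine Finset.sum_congr rfl fun i _ => ?_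
            rw [mul_comm, C_mul_X_pow_eq_monomial, Fin.val_succ]
          rw [SetLike.mem_coe, Ideal.mem_comap]
          rw [hc]
          exact sub_mem (Ideal.mem_sup_right hfm)
            (sum_mem fun i _ => Ideal.mul_mem_left _ _ (hsucc i))
        · intro a ha
          refine Ideal.mem_sup_right ?_
          rw [Module.mem_annihilator]
          intro z
          obtain ⟨z, rfl⟩ := Submodule.mkQ_surjective N z
          rw [← map_smul, show (C a : A[X]) • z = 0 from ?_, map_zero]
          rw [← PolynomialModule.coeff_inj]
          refine Finsupp.ext fun k => ?_
          rw [← monomial_zero_left, PolynomialModule.monomial_smul_apply]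
          simp [Module.mem_annihilator.1 ha]
      exact this (hy r hr)
lemma idealEq [IsNoetherianRing R] (I : Ideal R) (S : Type u) [AddCommGroup S] [Module R S]
    (h : ∀ i, EZ (ModuleCat.of R (R ⧸ I)) (ModuleCat.of R S) i) (s : S) :
    s ∈ I • (⊤ : Submodule R S) := by
  obtain ⟨n, y, hy⟩ := Submodule.fg_iff_exists_fin_generating_family.1
    ((isNoetherianRing_iff_ideal_fg R).1 inferInstance I)
  refine main_ind I n R S h y (fun i => ?_) (fun r hr => ?_) s
  · rw [Algebra.algebraMap_self, Ideal.map_id, ← hy]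
    exact Submodule.subset_span ⟨i, rfl⟩
  · refine Ideal.mem_sup_left ?_
    rw [← hy] at hr
    exact hr

theorem final [IsNoetherianRing R] (I : Ideal R) :
    (∀ i : ℕ, 2 ≤ i → Subsingleton (LC R I i (ModuleCat.of R R))) ↔
      ∀ M : ModuleCat.{u} R,
        (Subsingleton (ExtMod R 0 (ModuleCat.of R (R ⧸ I)) M) ∧
          Subsingleton (ExtMod R 1 (ModuleCat.of R (R ⧸ I)) M)) →
        ∀ i : ℕ, Subsingleton (ExtMod R i (ModuleCat.of R (R ⧸ I)) M) := by
  obtain ⟨S, _, _, f, hk, hc, h0, h1⟩ := exS I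
  have hS1 := ses_ker f.rangeRestrict f.surjective_rangeRestrict
  have hS2 := ses_mkQ (LinearMap.range f)
  have hG : ∀ x : LinearMap.ker f.rangeRestrict, tor I x := fun x =>
    tor_of_inj I (Submodule.subtype _) (Submodule.subtype_injective _) x
      (hk x.1 (congrArg Subtype.val (LinearMap.mem_ker.1 x.2)))
  constructor
  · rintro h M ⟨hM0, hM1⟩ i
    have hV : ∀ j ≥ 2, V I j (ModuleCat.of R S) := by
      intro j hj
      refine V_mid hS2 I j (V_right hS1 I j (V_tor I j _ hG)
        ((LC_iff I j (by omega) _).1 (h j hj))) ?_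
      obtain ⟨k, rfl⟩ : ∃ k, j = k + 1 := ⟨j - 1, by omega⟩
      exact V_tor I k _ hc
    have hall := EZ_of_V I _ h0 h1 hV
    rw [← EZ_iff] at hM0 hM1 ⊢
    exact EZ_of_ideal I S f hk hc (idealEq I S hall _) M hM0 hM1 i
  · intro h i hi
    have hall : ∀ j, EZ (ModuleCat.of R (R ⧸ I)) (ModuleCat.of R S) j := by
      intro j
      rw [EZ_iff]
      refine h _ ⟨?_, ?_⟩ j
      · rwa [← EZ_iff]
      · rwa [← EZ_iff]
    have hV := V_of_EZ I _ hall
    rw [LC_iff I i (by omega)]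
    obtain ⟨k, rfl⟩ : ∃ k, i = k + 2 := ⟨i - 2, by omega⟩
    exact V_mid hS1 I _ (V_tor I (k+1) _ hG) (V_left hS2 I (k+1) (hV _) (V_tor I k _ hc))

end S12

theorem stmt12 (R : Type u) [CommRing R] [IsNoetherianRing R] (I : Ideal R) :
    (∀ i : ℕ, 2 ≤ i → Subsingleton (LC R I i (ModuleCat.of R R))) ↔
      ∀ M : ModuleCat.{u} R,
        (Subsingleton (ExtMod R 0 (ModuleCat.of R (R ⧸ I)) M) ∧
          Subsingleton (ExtMod R 1 (ModuleCat.of R (R ⧸ I)) M)) →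
        ∀ i : ℕ, Subsingleton (ExtMod R i (ModuleCat.of R (R ⧸ I)) M) := by
  exact S12.final I
end
end
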